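/- Let X₁, …, X_N be C_b^∞-vector fields on ℝ^d satisfying the uniform Hörmander condition of order r, and let γ ∈ (0,1]. Then there exists c > 0 such that ‖φ‖_{2;γ r^{−1}} ≤ c ( Σ_{j=1}^N ‖φ‖_{2;X_j,γ} + ‖φ‖₂ ) for all φ ∈ C_c^∞(ℝ^d). -/

import Mathlib

open MeasureTheory Complex Real Finset

noncomputable section

/-- Euclidean space `ℝ^d`. -/
abbrev Ec (d : ℕ) := EuclideanSpace ℝ (Fin d)

variable {d : ℕ}

/-- The `L²` norm of a complex-valued function. -/
def l2norm (f : Ec d → ℂ) : ℝ := (∫ x, ‖f x‖ ^ 2).sqrt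

/-- Smooth compactly supported test functions. -/
def IsCc (φ : Ec d → ℂ) : Prop := ContDiff ℝ (⊤ : ℕ∞) φ ∧ HasCompactSupport φ

/-- A `C_b^∞`-vector field on `ℝ^d`: a smooth coefficient map `a : ℝ^d → ℝ^d` which is
bounded together with all its derivatives. -/
def IsCbVF (a : Ec d → Ec d) : Prop :=
  ContDiff ℝ (⊤ : ℕ∞) a ∧ ∀ n : ℕ, ∃ C : ℝ, ∀ x, ‖iteratedFDeriv ℝ n a x‖ ≤ C

/-- `f` is the (smooth, globally defined) flow `f t x = exp(tX)(x)` of the vector field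
with coefficient map `a`:  `f 0 x = x` and `∂_t f t x = a (f t x)`. -/
def IsFlowOf (a : Ec d → Ec d) (f : ℝ → Ec d → Ec d) : Prop :=
  ContDiff ℝ (⊤ : ℕ∞) (fun p : ℝ × Ec d => f p.1 p.2) ∧
    (∀ x, f 0 x = x) ∧
    ∀ t x, HasDerivAt (fun s => f s x) (a (f t x)) t

/-- The Hölder norm `‖φ‖_{2;X,γ} = ‖φ‖₂ + sup_{0<|t|≤1} |t|^{-γ} ‖e^{tX}φ - φ‖₂`
associated with the flow `f` of a vector field `X`. -/
def vfHolder (f : ℝ → Ec d → Ec d) (γ : ℝ) (φ : Ec d → ℂ) : ℝ :=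
  l2norm φ +
    sSup ((fun t : ℝ => |t| ^ (-γ) * l2norm fun x => φ (f t x) - φ x) ''
      {t : ℝ | 0 < |t| ∧ |t| ≤ 1})

/-- The universal Hölder norm
`‖φ‖_{2;γ} = ‖φ‖₂ + sup_{0<|z|≤1} |z|^{-γ} ‖φ(· - z) - φ‖₂`. -/
def uHolder (γ : ℝ) (φ : Ec d → ℂ) : ℝ :=
  l2norm φ +
    sSup ((fun z : Ec d => ‖z‖ ^ (-γ) * l2norm fun x => φ (x - z) - φ x) ''
      {z : Ec d | 0 < ‖z‖ ∧ ‖z‖ ≤ 1})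

/-- A smooth real-valued function which is bounded together with all its derivatives. -/
def IsCbR (ψ : Ec d → ℝ) : Prop :=
  ContDiff ℝ (⊤ : ℕ∞) ψ ∧ ∀ n : ℕ, ∃ C : ℝ, ∀ x, ‖iteratedFDeriv ℝ n ψ x‖ ≤ C

/-- The commutator `[X,Y]` of vector fields, as coefficient maps:
`[X,Y] = ∑_k (X b_k - Y a_k) ∂_k`. -/
def vfComm (a b : Ec d → Ec d) : Ec d → Ec d :=
  fun x => fderiv ℝ b x (a x) - fderiv ℝ a x (b x)

/-- The iterated commutator `X_{[α]} = [X_{i₁},[X_{i₂},…,[X_{i_{n-1}},X_{i_n}]…]]`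
associated with a multi-index `α` given as a list. -/
def multiComm {ι : Type*} (X : ι → Ec d → Ec d) : List ι → (Ec d → Ec d)
  | [] => fun _ => 0
  | [i] => X i
  | i :: j :: l => vfComm (X i) (multiComm X (j :: l))

/-- The uniform Hörmander condition of order `r`: every `C_b^∞`-vector field is a
`C_b^∞(ℝ^d)`-linear combination of the multi-commutators `X_{[α]}` with `1 ≤ |α| ≤ r`. -/
def UniformHormander {d N : ℕ} (X : Fin N → Ec d → Ec d) (r : ℕ) : Prop :=
  ∀ a : Ec d → Ec d, IsCbVF a →
    ∃ ψ : List (Fin N) → (Ec d → ℝ), (∀ l, IsCbR (ψ l)) ∧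
      ∀ x, a x = ∑ k ∈ Finset.Icc 1 r, ∑ v : Fin k → Fin N,
        ψ (List.ofFn v) x • multiComm X (List.ofFn v) x

section BoundedSmooth

variable {E F G : Type*} [NormedAddCommGroup E] [NormedSpace ℝ E] [NormedAddCommGroup F]
  [NormedSpace ℝ F] [NormedAddCommGroup G] [NormedSpace ℝ G]

/-- Smooth maps that are bounded together with all their derivatives. -/
def BddSmooth (f : E → F) : Prop :=
  ContDiff ℝ (⊤ : ℕ∞) f ∧ ∀ n : ℕ, ∃ C : ℝ, ∀ x, ‖iteratedFDeriv ℝ n f x‖ ≤ C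

namespace BddSmooth

lemma zero : BddSmooth (fun _ : E => (0 : F)) := by
  refine ⟨contDiff_const, fun n => ⟨0, fun x => ?_⟩⟩
  have := iteratedFDeriv_fun_zero (𝕜 := ℝ) (E := E) (F := F) (n := n)
  rw [this]; simp

lemma add {f g : E → F} (hf : BddSmooth f) (hg : BddSmooth g) :
    BddSmooth (fun x => f x + g x) := by
  refine ⟨hf.1.add hg.1, fun n => ?_⟩
  obtain ⟨C, hC⟩ := hf.2 n
  obtain ⟨C', hC'⟩ := hg.2 n
  refine ⟨C + C', fun x => ?_⟩
  have := iteratedFDeriv_add (i := n) (hf.1.of_le (by exact_mod_cast le_top))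
    (hg.1.of_le (by exact_mod_cast le_top)) (𝕜 := ℝ)
  change ‖iteratedFDeriv ℝ n (f + g) x‖ ≤ _
  rw [this]
  exact (norm_add_le _ _).trans (add_le_add (hC x) (hC' x))

lemma const_smul {f : E → F} (c : ℝ) (hf : BddSmooth f) : BddSmooth (fun x => c • f x) := by
  refine ⟨contDiff_const.smul hf.1, fun n => ?_⟩
  obtain ⟨C, hC⟩ := hf.2 n
  refine ⟨|c| * C, fun x => ?_⟩
  have := iteratedFDeriv_const_smul_apply (𝕜 := ℝ) (a := c) (f := f) (x := x) (i := n)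
    ((hf.1.of_le (by exact_mod_cast le_top)).contDiffAt)
  change ‖iteratedFDeriv ℝ n (c • f) x‖ ≤ _
  rw [this, norm_smul]
  exact mul_le_mul_of_nonneg_left (hC x) (abs_nonneg _)

lemma sub {f g : E → F} (hf : BddSmooth f) (hg : BddSmooth g) :
    BddSmooth (fun x => f x - g x) := by
  simpa [sub_eq_add_neg] using hf.add (hg.const_smul (-1))

lemma clm_apply {f : E → F →L[ℝ] G} {g : E → F} (hf : BddSmooth f) (hg : BddSmooth g) :
    BddSmooth (fun x => f x (g x)) := by
  refine ⟨hf.1.clm_apply hg.1, fun n => ?_⟩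
  choose A hA using hf.2
  choose B hB using hg.2
  refine ⟨∑ i ∈ Finset.range (n + 1), (n.choose i : ℝ) * A i * B (n - i), fun x => ?_⟩
  refine (norm_iteratedFDeriv_clm_apply hf.1 hg.1 x (by exact_mod_cast le_top)).trans ?_
  refine Finset.sum_le_sum fun i _ => ?_
  have := (norm_nonneg _).trans (hA i x)
  gcongr
  · exact hA i x
  · exact hB _ x

lemma fderiv {f : E → F} (hf : BddSmooth f) : BddSmooth (fderiv ℝ f) := by
  refine ⟨hf.1.fderiv_right (by exact_mod_cast le_top), fun n => ?_⟩
  obtain ⟨C, hC⟩ := hf.2 (n + 1)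
  exact ⟨C, fun x => by rw [norm_iteratedFDeriv_fderiv]; exact hC x⟩

lemma exists_bound {f : E → F} (hf : BddSmooth f) : ∃ C : ℝ, 0 ≤ C ∧ ∀ x, ‖f x‖ ≤ C := by
  obtain ⟨C, hC⟩ := hf.2 0
  refine ⟨C, (norm_nonneg _).trans (hC 0), fun x => ?_⟩
  simpa using hC x

lemma exists_lipschitz {f : E → F} (hf : BddSmooth f) : ∃ K : NNReal, LipschitzWith K f := by
  obtain ⟨C, hC0, hC⟩ := hf.fderiv.exists_bound
  refine ⟨⟨C, hC0⟩, lipschitzWith_of_nnnorm_fderiv_le (𝕜 := ℝ)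
    (hf.1.differentiable (by simp)) fun x => hC x⟩

end BddSmooth

end BoundedSmooth

lemma BddSmooth.vfComm {a b : Ec d → Ec d} (ha : BddSmooth a) (hb : BddSmooth b) :
    BddSmooth (vfComm a b) :=
  (hb.fderiv.clm_apply ha).sub (ha.fderiv.clm_apply hb)

lemma BddSmooth.multiComm {ι : Type*} {X : ι → Ec d → Ec d} (hX : ∀ i, BddSmooth (X i)) :
    ∀ l : List ι, BddSmooth (multiComm X l)
  | [] => BddSmooth.zero
  | [i] => hX i
  | i :: j :: l => (hX i).vfComm (BddSmooth.multiComm hX (j :: l))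

/-- Smooth self-maps of `ℝ^d` whose derivatives of order at least one are all bounded. -/
def tameMaps (d : ℕ) : Submodule ℝ (Ec d → Ec d) where
  carrier := {φ | ContDiff ℝ (⊤ : ℕ∞) φ ∧ BddSmooth (fderiv ℝ φ)}
  add_mem' := by
    rintro f g ⟨hf, hf'⟩ ⟨hg, hg'⟩
    refine ⟨hf.add hg, ?_⟩
    convert! hf'.add hg' using 1
    ext1 x
    exact fderiv_add (hf.differentiable (by simp) x) (hg.differentiable (by simp) x)
  zero_mem' := ⟨contDiff_const, BddSmooth.zero.fderiv⟩
  smul_mem' := by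
    rintro c f ⟨hf, hf'⟩
    refine ⟨contDiff_const.smul hf, ?_⟩
    convert! hf'.const_smul c using 1
    ext1 x
    exact fderiv_const_smul (hf.differentiable (by simp) x) c

/-- The identity map as an element of `tameMaps`. -/
def tameId (d : ℕ) : tameMaps d :=
  ⟨fun x => x, contDiff_id, by
    refine ⟨contDiff_id.fderiv_right (m := (⊤ : ℕ∞)) (by exact_mod_cast le_top), fun n => ?_⟩
    have h : (fderiv ℝ fun x : Ec d => x) = fun _ => ContinuousLinearMap.id ℝ (Ec d) := by
      ext1 x; exact fderiv_fun_id
    rw [h]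
    rcases Nat.eq_zero_or_pos n with rfl | hn
    · exact ⟨‖ContinuousLinearMap.id ℝ (Ec d)‖, fun x => by simp⟩
    · exact ⟨0, fun x => by rw [iteratedFDeriv_const_of_ne hn.ne']; simp⟩⟩

/-- The derivation of `tameMaps` along a vector field. -/
def vfOp (a : Ec d → Ec d) (ha : BddSmooth a) : Module.End ℝ (tameMaps d) where
  toFun φ := ⟨fun x => fderiv ℝ φ.1 x (a x),
    (φ.2.2.clm_apply ha).1, (φ.2.2.clm_apply ha).fderiv⟩
  map_add' φ ψ := by
    ext1; funext x
    change fderiv ℝ (φ.1 + ψ.1) x (a x) = fderiv ℝ φ.1 x (a x) + fderiv ℝ ψ.1 x (a x)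
    rw [fderiv_add (φ.2.1.differentiable (by simp) x) (ψ.2.1.differentiable (by simp) x)]
    rfl
  map_smul' c φ := by
    ext1; funext x
    change fderiv ℝ (c • φ.1) x (a x) = c • fderiv ℝ φ.1 x (a x)
    rw [fderiv_const_smul (φ.2.1.differentiable (by simp) x)]
    rfl

lemma vfOp_apply_bddSmooth (a : Ec d → Ec d) (ha : BddSmooth a) (φ : tameMaps d) :
    BddSmooth (vfOp a ha φ).1 := φ.2.2.clm_apply ha

lemma vfOp_tameId (a : Ec d → Ec d) (ha : BddSmooth a) (x : Ec d) :
    (vfOp a ha (tameId d)).1 x = a x := by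
  change fderiv ℝ (fun x : Ec d => x) x (a x) = a x
  simp

lemma vfOp_vfComm {a b : Ec d → Ec d} (ha : BddSmooth a) (hb : BddSmooth b) :
    vfOp (vfComm a b) (ha.vfComm hb) = vfOp a ha * vfOp b hb - vfOp b hb * vfOp a ha := by
  ext1 φ; ext1; funext x
  exact VectorField.fderiv_apply_lieBracket (V := a) (W := b) (n := 2)
    ((contDiff_infty.1 φ.2.1 2).contDiffAt (x := x)) (by simp)
    (hb.1.differentiable (by simp) x) (ha.1.differentiable (by simp) x)

section Expansion

/-- The time-dependent map `F` acts on `tameMaps` by composition with asymptotic expansion `p`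
as `t → 0`, uniformly in space. -/
def HasExpansion (F : ℝ → Ec d → Ec d) (p : PowerSeries (Module.End ℝ (tameMaps d))) : Prop :=
  ∀ (n : ℕ) (φ : tameMaps d), ∃ C : ℝ, ∀ t : ℝ, |t| ≤ 1 → ∀ x,
    ‖φ.1 (F t x) - ∑ j ∈ range (n + 1), t ^ j • (PowerSeries.coeff j p φ).1 x‖
      ≤ C * |t| ^ (n + 1)

/-- The exponential series of an endomorphism. -/
def expSeries (D : Module.End ℝ (tameMaps d)) : PowerSeries (Module.End ℝ (tameMaps d)) :=
  PowerSeries.mk fun n => ((n.factorial : ℝ)⁻¹) • D ^ n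

lemma hasExpansion_id : HasExpansion (d := d) (fun _ x => x) 1 := by
  intro n φ
  refine ⟨0, fun t _ x => ?_⟩
  rw [Finset.sum_range_succ', Finset.sum_eq_zero]
  · simp
  · intro j _
    rw [PowerSeries.coeff_one, if_neg (Nat.succ_ne_zero j)]
    simp

lemma HasExpansion.mul {F G : ℝ → Ec d → Ec d} {p q : PowerSeries (Module.End ℝ (tameMaps d))}
    (hF : HasExpansion F p) (hG : HasExpansion G q) :
    HasExpansion (fun t x => G t (F t x)) (p * q) := by
  intro n φ
  obtain ⟨C, hC⟩ := hG n φ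
  choose B hB using fun j => hF (n - j) (PowerSeries.coeff j q φ)
  refine ⟨C + ∑ j ∈ range (n + 1), B j, fun t ht x => ?_⟩
  have hsum : ∑ m ∈ range (n + 1), t ^ m • (PowerSeries.coeff m (p * q) φ).1 x
      = ∑ j ∈ range (n + 1), t ^ j • ∑ i ∈ range (n - j + 1),
          t ^ i • (PowerSeries.coeff i p (PowerSeries.coeff j q φ)).1 x := by
    have h1 : ∀ m, t ^ m • (PowerSeries.coeff m (p * q) φ).1 x
        = ∑ j ∈ range (m + 1),
          t ^ j • t ^ (m - j) • (PowerSeries.coeff (m - j) p (PowerSeries.coeff j q φ)).1 x := by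
      intro m
      rw [PowerSeries.coeff_mul, Finset.Nat.sum_antidiagonal_eq_sum_range_succ
        (fun i j => PowerSeries.coeff i p * PowerSeries.coeff j q),
        ← Finset.sum_range_reflect]
      simp only [LinearMap.sum_apply, Submodule.coe_sum, Finset.sum_apply, Finset.smul_sum]
      refine Finset.sum_congr rfl fun j hj => ?_
      have hj' : j ≤ m := by simpa [Nat.lt_succ_iff] using hj
      rw [smul_smul, ← pow_add, Nat.add_sub_cancel' hj',
        show m + 1 - 1 - j = m - j by omega, Nat.sub_sub_self hj']
      rfl
    simp only [h1, Finset.smul_sum]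
    rw [Finset.sum_sigma', Finset.sum_sigma']
    refine Finset.sum_bij' (fun a _ => ⟨a.2, a.1 - a.2⟩) (fun a _ => ⟨a.1 + a.2,
        a.1⟩) ?_ ?_ ?_ ?_ ?_
    · rintro ⟨m, j⟩ h
      simp only [Finset.mem_sigma, Finset.mem_range] at h ⊢
      omega
    · rintro ⟨m, j⟩ h
      simp only [Finset.mem_sigma, Finset.mem_range] at h ⊢
      omega
    · rintro ⟨m, j⟩ h
      simp only [Finset.mem_sigma, Finset.mem_range] at h ⊢
      simp only [Sigma.mk.injEq, heq_eq_eq, and_true]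
      omega
    · rintro ⟨m, j⟩ h
      simp
    · rintro ⟨m, j⟩ h
      rfl
  rw [hsum]
  have hsplit : φ.1 (G t (F t x)) - ∑ j ∈ range (n + 1), t ^ j • ∑ i ∈ range (n - j + 1),
          t ^ i • (PowerSeries.coeff i p (PowerSeries.coeff j q φ)).1 x
      = (φ.1 (G t (F t x)) - ∑ j ∈ range (n + 1), t ^ j • (PowerSeries.coeff j q φ).1 (F t x))
        + ∑ j ∈ range (n + 1), t ^ j • ((PowerSeries.coeff j q φ).1 (F t x)
          - ∑ i ∈ range (n - j + 1),
              t ^ i • (PowerSeries.coeff i p (PowerSeries.coeff j q φ)).1 x) := by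
    simp only [smul_sub, Finset.sum_sub_distrib]
    abel
  rw [hsplit, add_mul, Finset.sum_mul]
  refine (norm_add_le _ _).trans (add_le_add (hC t ht _) ((norm_sum_le _ _).trans ?_))
  refine Finset.sum_le_sum fun j hj => ?_
  have hj' : j ≤ n := by simpa [Nat.lt_succ_iff] using hj
  rw [norm_smul, norm_pow, Real.norm_eq_abs]
  calc |t| ^ j * _ ≤ |t| ^ j * (B j * |t| ^ (n - j + 1)) := by
        gcongr; exact hB j t ht x
    _ = B j * |t| ^ (n + 1) := by
        rw [show n + 1 = j + (n - j + 1) by omega, pow_add]; ring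

lemma hasExpansion_flow {a : Ec d → Ec d} (ha : BddSmooth a) {f : ℝ → Ec d → Ec d}
    (h0 : ∀ x, f 0 x = x) (hf : ∀ t x, HasDerivAt (fun s => f s x) (a (f t x)) t) :
    HasExpansion f (expSeries (vfOp a ha)) := by
  have hderiv : ∀ (φ : tameMaps d) t x,
      HasDerivAt (fun s => φ.1 (f s x)) ((vfOp a ha φ).1 (f t x)) t := fun φ t x =>
    ((φ.2.1.differentiable (by simp) (f t x)).hasFDerivAt).comp_hasDerivAt t (hf t x)
  have key : ∀ (t : ℝ) (g g' : ℝ → Ec d) (C : ℝ), (∀ s, HasDerivAt g (g' s) s) →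
      (∀ s, |s| ≤ |t| → ‖g' s‖ ≤ C) → ‖g t - g 0‖ ≤ C * |t| := by
    intro t g g' C hg hC
    have := Convex.norm_image_sub_le_of_norm_hasDerivWithin_le (s := Set.uIcc 0 t) (C := C)
      (f := g) (f' := g') (x := 0) (y := t) (fun s _ => (hg s).hasDerivWithinAt) (fun s hs => ?_)
      (convex_uIcc 0 t) Set.left_mem_uIcc Set.right_mem_uIcc
    · simpa using this
    · have := Set.abs_sub_left_of_mem_uIcc hs
      exact hC s (by simpa using this)
  intro n
  induction n with
  | zero =>
    intro φ
    obtain ⟨C, _, hC⟩ := (vfOp_apply_bddSmooth a ha φ).exists_bound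
    refine ⟨C, fun t _ x => ?_⟩
    have := key t _ _ C (fun s => hderiv φ s x) (fun s _ => hC _)
    simpa [expSeries, h0] using this
  | succ n ih =>
    intro φ
    obtain ⟨C, hC⟩ := ih (vfOp a ha φ)
    refine ⟨C, fun t ht x => ?_⟩
    have hg : ∀ s, HasDerivAt (fun s => φ.1 (f s x)
        - ∑ j ∈ range (n + 1 + 1), s ^ j • (PowerSeries.coeff j (expSeries (vfOp a ha)) φ).1 x)
        ((vfOp a ha φ).1 (f s x) - ∑ j ∈ range (n + 1),
          s ^ j • (PowerSeries.coeff j (expSeries (vfOp a ha)) (vfOp a ha φ)).1 x) s := by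
      intro s
      refine (hderiv φ s x).sub ?_
      have h2 : ∀ j ∈ range (n + 1 + 1), HasDerivAt
          (fun s : ℝ => s ^ j • (PowerSeries.coeff j (expSeries (vfOp a ha)) φ).1 x)
          (((j : ℝ) * s ^ (j - 1)) • (PowerSeries.coeff j (expSeries (vfOp a ha)) φ).1 x) s :=
        fun j _ => (hasDerivAt_pow j s).smul_const _
      convert HasDerivAt.fun_sum h2 using 1
      rw [Finset.sum_range_succ' _ (n + 1)]
      simp only [Nat.cast_zero, zero_mul, zero_smul, add_zero]
      refine Finset.sum_congr rfl fun j _ => ?_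
      simp only [expSeries, PowerSeries.coeff_mk, pow_succ, Nat.add_sub_cancel]
      change s ^ j • ((j.factorial : ℝ)⁻¹ • ((vfOp a ha ^ j) (vfOp a ha φ)).1 x)
        = _ • (((j + 1).factorial : ℝ)⁻¹ • ((vfOp a ha ^ j) (vfOp a ha φ)).1 x)
      rw [smul_smul, smul_smul]
      congr 1
      rw [Nat.factorial_succ]
      push_cast
      have : (j.factorial : ℝ) ≠ 0 := by positivity
      field_simp
    have hz : (fun s => φ.1 (f s x) - ∑ j ∈ range (n + 1 + 1),
        s ^ j • (PowerSeries.coeff j (expSeries (vfOp a ha)) φ).1 x) 0 = 0 := by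
      simp [Finset.sum_range_succ' _ (n + 1), expSeries, h0]
    have := key t _ _ (C * |t| ^ (n + 1)) hg (fun s hs => (hC s (hs.trans ht) x).trans ?_)
    · beta_reduce at hz
      rw [hz, sub_zero] at this
      calc _ ≤ C * |t| ^ (n + 1) * |t| := this
        _ = _ := by ring
    · have hC0 : 0 ≤ C := by
        have h1 := (norm_nonneg _).trans (hC 1 (by simp) x)
        simpa using h1
      gcongr

end Expansion

section Words

variable {ι : Type*}

/-- The sign attached to a letter of a word: `true` for a forward flow, `false` for a backward
flow. -/
def timeSign (b : Bool) : ℝ := if b then 1 else -1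

lemma abs_timeSign (b : Bool) : |timeSign b| = 1 := by cases b <;> simp [timeSign]

/-- The composition of the flows prescribed by a word, the last letter acting first. -/
def wordMap (f : ι → ℝ → Ec d → Ec d) : List (ι × Bool) → ℝ → Ec d → Ec d
  | [], _, x => x
  | l :: w, t, x => f l.1 (timeSign l.2 * t) (wordMap f w t x)

/-- The formal series of the pull-back by `wordMap`. -/
def wordSeries (D : ι → Module.End ℝ (tameMaps d)) :
    List (ι × Bool) → PowerSeries (Module.End ℝ (tameMaps d))
  | [] => 1
  | l :: w => wordSeries D w * expSeries (timeSign l.2 • D l.1)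

/-- The inverse word. -/
def invWord (w : List (ι × Bool)) : List (ι × Bool) := (w.map fun l => (l.1, !l.2)).reverse

/-- The word of group commutators associated with an iterated commutator. -/
def commWord : List ι → List (ι × Bool)
  | [] => []
  | [i] => [(i, true)]
  | i :: j :: l =>
    invWord (commWord (j :: l)) ++ ((i, false) :: (commWord (j :: l) ++ [(i, true)]))

lemma vfOp_smul {a : Ec d → Ec d} (ha : BddSmooth a) (c : ℝ) :
    vfOp (fun x => c • a x) (ha.const_smul c) = c • vfOp a ha := by
  ext1 φ; ext1; funext x
  change fderiv ℝ φ.1 x (c • a x) = c • fderiv ℝ φ.1 x (a x)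
  simp

lemma hasExpansion_wordMap {X : ι → Ec d → Ec d} (hX : ∀ i, BddSmooth (X i))
    {f : ι → ℝ → Ec d → Ec d} (h0 : ∀ i x, f i 0 x = x)
    (hf : ∀ i t x, HasDerivAt (fun s => f i s x) (X i (f i t x)) t) (w : List (ι × Bool)) :
    HasExpansion (wordMap f w) (wordSeries (fun i => vfOp (X i) (hX i)) w) := by
  induction w with
  | nil => exact hasExpansion_id
  | cons l w ih =>
    refine HasExpansion.mul (G := fun t x => f l.1 (timeSign l.2 * t) x) ih ?_
    have := hasExpansion_flow ((hX l.1).const_smul (timeSign l.2))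
      (f := fun t x => f l.1 (timeSign l.2 * t) x) (by simp [h0]) (fun t x => ?_)
    · rwa [vfOp_smul] at this
    · have h1 : HasDerivAt (fun s : ℝ => timeSign l.2 * s) (timeSign l.2) t := by
        simpa using (hasDerivAt_id t).const_mul (timeSign l.2)
      exact (hf l.1 (timeSign l.2 * t) x).scomp t h1

lemma wordSeries_append (D : ι → Module.End ℝ (tameMaps d)) (w w' : List (ι × Bool)) :
    wordSeries D (w ++ w') = wordSeries D w' * wordSeries D w := by
  induction w with
  | nil => simp [wordSeries]
  | cons l w ih => simp [wordSeries, ih, mul_assoc]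

lemma neg_one_smul_end (D : Module.End ℝ (tameMaps d)) : (-1 : ℝ) • D = -D := by
  ext1 φ
  exact neg_one_smul ℝ (D φ)

lemma expSeries_mul_neg (D : Module.End ℝ (tameMaps d)) :
    expSeries D * expSeries (-D) = 1 := by
  have key : ∀ c : ℝ, expSeries (c • D) = PowerSeries.map (Polynomial.aeval (R := ℝ) D).toRingHom
      (PowerSeries.rescale (Polynomial.C c * Polynomial.X)
        (PowerSeries.exp (Polynomial ℝ))) := by
    intro c
    ext1 n
    simp only [expSeries, PowerSeries.coeff_mk, PowerSeries.coeff_map, PowerSeries.coeff_rescale,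
      PowerSeries.coeff_exp]
    have h1 : (algebraMap ℚ (Polynomial ℝ)) (1 / (n.factorial : ℚ))
        = Polynomial.C ((n.factorial : ℝ)⁻¹) := by
      rw [IsScalarTower.algebraMap_apply ℚ ℝ (Polynomial ℝ)]
      simp [Polynomial.algebraMap_eq]
    rw [h1, mul_pow, ← Polynomial.C_pow]
    change _ = (Polynomial.aeval (R := ℝ) D) _
    simp only [map_mul, map_pow, Polynomial.aeval_C, Polynomial.aeval_X, smul_pow]
    simp only [Algebra.algebraMap_eq_smul_one, smul_pow, one_pow, smul_mul_assoc, one_mul,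
      mul_smul_comm, mul_one]
  have h1 := key 1
  have h2 := key (-1)
  rw [one_smul] at h1
  rw [neg_one_smul_end] at h2
  rw [h1, h2, ← map_mul, PowerSeries.exp_mul_exp_eq_exp_add]
  simp

lemma expSeries_sign_mul (D : Module.End ℝ (tameMaps d)) (b : Bool) :
    expSeries (timeSign b • D) * expSeries (timeSign (!b) • D) = 1 := by
  cases b
  · have h := expSeries_mul_neg (-D)
    rw [show - -D = D from neg_neg D] at h
    simpa [timeSign, neg_one_smul_end] using h
  · simpa [timeSign, neg_one_smul_end] using expSeries_mul_neg D

lemma wordSeries_invWord (D : ι → Module.End ℝ (tameMaps d)) (w : List (ι × Bool)) :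
    wordSeries D (invWord w) * wordSeries D w = 1 ∧
      wordSeries D w * wordSeries D (invWord w) = 1 := by
  induction w with
  | nil => simp [wordSeries, invWord]
  | cons l w ih =>
    have h : invWord (l :: w) = invWord w ++ [(l.1, !l.2)] := by simp [invWord]
    rw [h, wordSeries_append]
    have h1 := expSeries_sign_mul (D l.1) l.2
    have h2 := expSeries_sign_mul (D l.1) (!l.2)
    rw [Bool.not_not] at h2
    simp only [wordSeries, one_mul]
    constructor
    · rw [mul_assoc, ← mul_assoc (wordSeries D (invWord w)), ih.1, one_mul, h2]
    · rw [mul_assoc, ← mul_assoc (expSeries (timeSign l.2 • D l.1)), h1, one_mul, ih.2]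

section LeadingTerm

variable {R : Type*} [Ring R]

/-- The series `p` is `1 + t ^ k D + O(t ^ (k + 1))`. -/
def HasLeadingTerm (p : PowerSeries R) (k : ℕ)
    (D : R) : Prop :=
  ∃ v, p = 1 + PowerSeries.X ^ k * v ∧ PowerSeries.constantCoeff v = D

lemma HasLeadingTerm.constantCoeff_eq {p : PowerSeries R} {k : ℕ}
    {D : R} (hk : 1 ≤ k) (hp : HasLeadingTerm p k D) :
    PowerSeries.constantCoeff p = 1 := by
  obtain ⟨v, rfl, _⟩ := hp
  simp [zero_pow (by omega : k ≠ 0)]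

lemma HasLeadingTerm.inv {p q : PowerSeries R} {k : ℕ}
    {D : R} (hk : 1 ≤ k) (hp : HasLeadingTerm p k D) (hqp : q * p = 1) :
    HasLeadingTerm q k (-D) := by
  have h1 := hp.constantCoeff_eq hk
  have hq : PowerSeries.constantCoeff q = 1 := by
    have := congrArg PowerSeries.constantCoeff hqp
    rwa [map_mul, h1, mul_one, map_one] at this
  obtain ⟨v, rfl, hv⟩ := hp
  refine ⟨-(q * v), ?_, by simp [hq, hv]⟩
  rw [mul_add, mul_one, ← mul_assoc, (PowerSeries.commute_X_pow q k).eq] at hqp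
  rw [mul_neg, ← mul_assoc, ← hqp]
  abel

lemma HasLeadingTerm.commutator {p p' q q' : PowerSeries R} {k : ℕ}
    {A B : R} (hk : 1 ≤ k) (hp : HasLeadingTerm p 1 A)
    (hq : HasLeadingTerm q k B) (hpp : p * p' = 1) (hqq : q * q' = 1) :
    HasLeadingTerm (p * q * p' * q') (k + 1) (A * B - B * A) := by
  have hp1 := hp.constantCoeff_eq le_rfl
  have hq1 := hq.constantCoeff_eq hk
  have hp' : PowerSeries.constantCoeff p' = 1 := by
    have := congrArg PowerSeries.constantCoeff hpp
    rwa [map_mul, hp1, one_mul, map_one] at this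
  have hq' : PowerSeries.constantCoeff q' = 1 := by
    have := congrArg PowerSeries.constantCoeff hqq
    rwa [map_mul, hq1, one_mul, map_one] at this
  obtain ⟨u, hu, rfl⟩ := hp
  obtain ⟨v, hv, rfl⟩ := hq
  refine ⟨(u * v - v * u) * p' * q', ?_, by simp [hp', hq']⟩
  have h1 : p * q - q * p = PowerSeries.X ^ (k + 1) * (u * v - v * u) := by
    have e1 : PowerSeries.X ^ 1 * u * (PowerSeries.X ^ k * v)
        = PowerSeries.X ^ (k + 1) * (u * v) := by
      rw [mul_assoc, ← mul_assoc u, (PowerSeries.commute_X_pow u k).eq, ← mul_assoc,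
        ← mul_assoc, ← pow_add, add_comm 1 k, mul_assoc]
    have e2 : PowerSeries.X ^ k * v * (PowerSeries.X ^ 1 * u)
        = PowerSeries.X ^ (k + 1) * (v * u) := by
      rw [mul_assoc, ← mul_assoc v, (PowerSeries.commute_X_pow v 1).eq, ← mul_assoc,
        ← mul_assoc, ← pow_add, mul_assoc]
    rw [hu, hv, mul_sub (PowerSeries.X ^ (k + 1)), ← e1, ← e2]
    simp only [mul_add, add_mul, one_mul, mul_one]
    abel
  have h2 : q * p * p' * q' = 1 := by
    rw [mul_assoc q, hpp, mul_one, hqq]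
  calc p * q * p' * q' = q * p * p' * q' + (p * q - q * p) * p' * q' := by
        rw [sub_mul, sub_mul]; abel
    _ = _ := by rw [h2, h1]; simp only [mul_assoc]

end LeadingTerm

lemma expSeries_hasLeadingTerm (D : Module.End ℝ (tameMaps d)) :
    HasLeadingTerm (expSeries D) 1 D := by
  refine ⟨PowerSeries.mk fun n => PowerSeries.coeff (n + 1) (expSeries D), ?_, ?_⟩
  · ext1 n
    cases n with
    | zero => simp [expSeries]
    | succ n => simp [PowerSeries.coeff_succ_X_mul, PowerSeries.coeff_one]
  · simp [← PowerSeries.coeff_zero_eq_constantCoeff_apply, expSeries]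

lemma wordSeries_commWord {X : ι → Ec d → Ec d} (hX : ∀ i, BddSmooth (X i)) (l : List ι)
    (hl : l ≠ []) :
    HasLeadingTerm (wordSeries (fun i => vfOp (X i) (hX i)) (commWord l)) l.length
      (vfOp (multiComm X l) (BddSmooth.multiComm hX l)) := by
  induction l with
  | nil => exact absurd rfl hl
  | cons i l ih =>
    cases l with
    | nil =>
      simpa [commWord, wordSeries, timeSign, multiComm] using
        expSeries_hasLeadingTerm (vfOp (X i) (hX i))
    | cons j l =>
      have := HasLeadingTerm.commutator (p' := expSeries (-(vfOp (X i) (hX i))))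
        (by simp) (expSeries_hasLeadingTerm (vfOp (X i) (hX i))) (ih (by simp))
        (expSeries_mul_neg _) (wordSeries_invWord (fun i => vfOp (X i) (hX i)) _).2
      rw [← vfOp_vfComm] at this
      change HasLeadingTerm _ _ (vfOp (vfComm (X i) (multiComm X (j :: l))) _)
      simpa [commWord, wordSeries, wordSeries_append, timeSign, mul_assoc, neg_one_smul_end]
        using this

lemma HasExpansion.exists_bound {F : ℝ → Ec d → Ec d}
    {p : PowerSeries (Module.End ℝ (tameMaps d))} (hF : HasExpansion F p) {k : ℕ} (hk : 1 ≤ k)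
    {b : Ec d → Ec d} {D : Module.End ℝ (tameMaps d)} (hp : HasLeadingTerm p k D)
    (hD : ∀ x, (D (tameId d)).1 x = b x) :
    ∃ C : ℝ, ∀ t : ℝ, |t| ≤ 1 → ∀ x, ‖F t x - x - t ^ k • b x‖ ≤ C * |t| ^ (k + 1) := by
  obtain ⟨C, hC⟩ := hF k (tameId d)
  refine ⟨C, fun t ht x => ?_⟩
  have hsum : ∑ j ∈ range (k + 1), t ^ j • (PowerSeries.coeff j p (tameId d)).1 x
      = x + t ^ k • b x := by
    obtain ⟨v, rfl, hv⟩ := hp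
    obtain ⟨m, rfl⟩ : ∃ m, k = m + 1 := ⟨k - 1, by omega⟩
    rw [Finset.sum_range_succ, Finset.sum_range_succ', Finset.sum_eq_zero]
    · simp [PowerSeries.coeff_one, PowerSeries.coeff_X_pow_mul', hv, hD]
      rfl
    · intro j hj
      have : ¬ (m + 1 ≤ j + 1) := by simp at hj; omega
      simp only [map_add, PowerSeries.coeff_one, PowerSeries.coeff_X_pow_mul', if_neg this,
        if_neg (Nat.succ_ne_zero j)]
      simp
  have := hC t ht x
  rw [hsum] at this
  rw [sub_sub]
  exact this

end Words

section Flow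

variable {a : Ec d → Ec d} {f : ℝ → Ec d → Ec d}

lemma flow_add {K : NNReal} (ha : LipschitzWith K a) (h0 : ∀ x, f 0 x = x)
    (hf : ∀ t x, HasDerivAt (fun s => f s x) (a (f t x)) t) (u v : ℝ) (x : Ec d) :
    f (u + v) x = f u (f v x) := by
  have := ODE_solution_unique_univ (v := fun _ => a) (s := fun _ => Set.univ) (K := K) (t₀ := 0)
    (f := fun u => f (u + v) x) (g := fun u => f u (f v x))
    (fun _ => ha.lipschitzOnWith)
    (fun t => ⟨(hf (t + v) x).comp_add_const t v, trivial⟩)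
    (fun t => ⟨hf t _, trivial⟩) (by simp [h0])
  exact congrFun this u

lemma flow_time_lipschitz {M : ℝ} (hM : ∀ x, ‖a x‖ ≤ M)
    (hf : ∀ t x, HasDerivAt (fun s => f s x) (a (f t x)) t) (u v : ℝ) (x : Ec d) :
    ‖f u x - f v x‖ ≤ M * |u - v| := by
  simpa using Convex.norm_image_sub_le_of_norm_hasDerivWithin_le (s := Set.univ) (C := M)
    (f := fun s => f s x) (fun s _ => (hf s x).hasDerivWithinAt) (fun s _ => hM _)
    convex_univ (Set.mem_univ v) (Set.mem_univ u)

lemma flow_dist_le_of_nonneg {K : NNReal} (ha : LipschitzWith K a) (h0 : ∀ x, f 0 x = x)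
    (hf : ∀ t x, HasDerivAt (fun s => f s x) (a (f t x)) t) {u : ℝ} (hu : u ∈ Set.Icc 0 1)
    (x y : Ec d) : ‖f u x - f u y‖ ≤ ‖x - y‖ * Real.exp K := by
  have := dist_le_of_trajectories_ODE (v := fun _ => a) (K := K) (a := 0) (b := 1)
    (f := fun u => f u x) (g := fun u => f u y) (δ := ‖x - y‖) (fun _ => ha)
    (fun t _ => (hf t x).continuousAt.continuousWithinAt)
    (fun t _ => (hf t x).hasDerivWithinAt)
    (fun t _ => (hf t y).continuousAt.continuousWithinAt)
    (fun t _ => (hf t y).hasDerivWithinAt) (by simp [h0, dist_eq_norm]) u hu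
  rw [dist_eq_norm] at this
  refine this.trans ?_
  gcongr
  have := mul_le_mul_of_nonneg_left hu.2 K.coe_nonneg
  simpa using this

lemma flow_dist_le {K : NNReal} (ha : LipschitzWith K a) (h0 : ∀ x, f 0 x = x)
    (hf : ∀ t x, HasDerivAt (fun s => f s x) (a (f t x)) t) {u : ℝ} (hu : |u| ≤ 1)
    (x y : Ec d) : ‖f u x - f u y‖ ≤ ‖x - y‖ * Real.exp K := by
  rcases le_total 0 u with h | h
  · exact flow_dist_le_of_nonneg ha h0 hf ⟨h, (abs_le.1 hu).2⟩ x y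
  · have := flow_dist_le_of_nonneg (a := fun x => -a x) (f := fun t => f (-t)) (K := K)
      ha.neg (by simpa using h0) (fun t x => ?_) (u := -u)
      ⟨by linarith, by linarith [(abs_le.1 hu).1]⟩ x y
    · simpa using this
    · have h1 := (hf (-t) x).scomp t (hasDerivAt_neg t)
      rw [neg_one_smul] at h1
      exact h1

lemma flow_sub_id_lipschitz {K : NNReal} (ha : LipschitzWith K a) (h0 : ∀ x, f 0 x = x)
    (hf : ∀ t x, HasDerivAt (fun s => f s x) (a (f t x)) t) {u : ℝ} (hu : |u| ≤ 1)
    (x y : Ec d) :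
    ‖(f u x - x) - (f u y - y)‖ ≤ K * Real.exp K * |u| * ‖x - y‖ := by
  have := Convex.norm_image_sub_le_of_norm_hasDerivWithin_le (s := Set.uIcc 0 u)
    (C := K * (‖x - y‖ * Real.exp K)) (x := 0) (y := u)
    (f := fun s => f s x - f s y) (fun s _ => ((hf s x).sub (hf s y)).hasDerivWithinAt)
    (fun s hs => ?_) (convex_uIcc 0 u) Set.left_mem_uIcc Set.right_mem_uIcc
  · simp only [h0, sub_zero, Real.norm_eq_abs] at this
    calc ‖(f u x - x) - (f u y - y)‖ = ‖f u x - f u y - (x - y)‖ := by congr 1; abel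
      _ ≤ _ := this
      _ = _ := by ring
  · have h1 := Set.abs_sub_left_of_mem_uIcc hs
    simp only [sub_zero] at h1
    refine (ha.norm_sub_le _ _).trans ?_
    gcongr
    exact flow_dist_le ha h0 hf (h1.trans hu) x y

end Flow

section Averaging

open scoped ENNReal

lemma eLpNorm_two_sq {α : Type*} [MeasurableSpace α] {μ : Measure α} (f : α → ℂ) :
    eLpNorm f 2 μ ^ 2 = ∫⁻ x, ‖f x‖ₑ ^ 2 ∂μ := by
  rw [eLpNorm_eq_lintegral_rpow_enorm_toReal (by simp) (by simp), ← ENNReal.rpow_natCast,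
    ← ENNReal.rpow_mul]
  simp

lemma eLpNorm_two_le_iff {α : Type*} [MeasurableSpace α] {μ : Measure α} (f : α → ℂ)
    (B : ℝ≥0∞) : eLpNorm f 2 μ ≤ B ↔ ∫⁻ x, ‖f x‖ₑ ^ 2 ∂μ ≤ B ^ 2 := by
  rw [← eLpNorm_two_sq, ENNReal.pow_le_pow_left_iff two_ne_zero]

lemma continuous_of_lipschitz_sub_id {K : NNReal} {G : Ec d → Ec d}
    (hG : LipschitzWith K fun x => G x - x) : Continuous G := by
  have h : G = fun x => (G x - x) + x := by funext x; abel
  rw [h]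
  exact hG.continuous.add continuous_id

/-- A `1 / 2`-Lipschitz perturbation of the identity distorts volumes by a bounded factor. -/
lemma map_volume_le {G : Ec d → Ec d} (hG : LipschitzWith (1 / 2) fun x => G x - x) :
    Measure.map G volume ≤ (2 ^ d : ℝ≥0∞) • (volume : Measure (Ec d)) := by
  have hcont : Continuous G := continuous_of_lipschitz_sub_id hG
  have hanti : AntilipschitzWith 2 G := by
    refine AntilipschitzWith.of_le_mul_dist fun x y => ?_
    have h1 := hG.norm_sub_le x y
    have h2 : ‖x - y‖ ≤ ‖G x - G y‖ + ‖G x - x - (G y - y)‖ := by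
      calc ‖x - y‖ = ‖(G x - G y) - (G x - x - (G y - y))‖ := by congr 1; abel
        _ ≤ _ := norm_sub_le _ _
    rw [dist_eq_norm, dist_eq_norm]
    push_cast at h1 ⊢
    linarith
  refine Measure.le_iff.2 fun s hs => ?_
  rw [Measure.map_apply hcont.measurable hs, Measure.smul_apply, smul_eq_mul]
  have h := hanti.hausdorffMeasure_preimage_le (d := (d : ℝ)) (by positivity) s
  have hvol := Measure.isAddLeftInvariant_eq_smul (volume : Measure (Ec d)) (μH[(d : ℝ)])
  rw [hvol, Measure.smul_apply, Measure.smul_apply]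
  simp only [ENNReal.smul_def, smul_eq_mul]
  calc _ ≤ _ := mul_le_mul_right h _
    _ = _ := by
      simp only [ENNReal.coe_ofNat, ENNReal.rpow_natCast]
      ring

lemma lintegral_comp_le {G : Ec d → Ec d} (hG : Continuous G)
    (hmap : Measure.map G volume ≤ (2 ^ d : ℝ≥0∞) • (volume : Measure (Ec d)))
    {g : Ec d → ℝ≥0∞} (hg : Measurable g) : ∫⁻ x, g (G x) ≤ 2 ^ d * ∫⁻ x, g x := by
  rw [← lintegral_map hg hG.measurable, ← smul_eq_mul, ← lintegral_smul_measure]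
  exact lintegral_mono' hmap le_rfl

variable {E : Type*} [NormedAddCommGroup E] [NormedSpace ℝ E] [MeasurableSpace E] [BorelSpace E]
  [FiniteDimensional ℝ E]

/-- Displacing a map along an action by a position-dependent amount is controlled by
displacements by constant amounts. -/
lemma lintegral_displacement_le (μ : Measure E) [μ.IsAddHaarMeasure] {Φ : E → Ec d → Ec d}
    (hΦ : Continuous fun p : E × Ec d => Φ p.1 p.2)
    (hadd : ∀ u v x, Φ (u + v) x = Φ u (Φ v x)) {φ : Ec d → ℂ} (hφ : Continuous φ)
    {G G' : Ec d → Ec d} (hG : LipschitzWith (1 / 2) fun x => G x - x)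
    (hG' : LipschitzWith (1 / 2) fun x => G' x - x) {τ : Ec d → E} {ρ : ℝ} (hρ : 0 < ρ)
    (hτ : ∀ x, ‖τ x‖ ≤ ρ) (hGG' : ∀ x, G' x = Φ (τ x) (G x)) {S : ℝ≥0∞}
    (hS : ∀ u, ‖u‖ ≤ 2 * ρ → ∫⁻ y, ‖φ (Φ u y) - φ y‖ₑ ^ 2 ≤ S) :
    ∫⁻ x, ‖φ (G' x) - φ (G x)‖ₑ ^ 2
      ≤ 2 ^ (Module.finrank ℝ E + 2 + d) * S := by
  have hc : Continuous G := continuous_of_lipschitz_sub_id hG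
  have hc' : Continuous G' := continuous_of_lipschitz_sub_id hG'
  obtain ⟨q, hq⟩ : ∃ q : E → Ec d → ℝ≥0∞, ∀ u y, q u y = ‖φ (Φ u y) - φ y‖ₑ ^ 2 := ⟨_,
      fun _ _ => rfl⟩
  have hqm : Measurable fun p : E × Ec d => q p.1 p.2 := by
    have : Continuous fun p : E × Ec d => φ (Φ p.1 p.2) - φ p.2 :=
      (hφ.comp hΦ).sub (hφ.comp continuous_snd)
    simpa only [hq] using (this.measurable.enorm).pow_const 2
  set V := μ (Metric.ball (0 : E) ρ)
  set W := μ (Metric.ball (0 : E) (2 * ρ))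
  have hV0 : V ≠ 0 := (Metric.measure_ball_pos μ 0 hρ).ne'
  have hVt : V ≠ ∞ := measure_ball_lt_top.ne
  have hW : W = 2 ^ Module.finrank ℝ E * V := by
    have := Measure.addHaar_ball_mul_of_pos μ (0 : E) (r := 2) (by norm_num) ρ
    rw [show W = _ from this, ENNReal.ofReal_pow (by norm_num)]
    simp [V]
  have hpt : ∀ x, V * ‖φ (G' x) - φ (G x)‖ₑ ^ 2
      ≤ 2 * (∫⁻ u in Metric.ball (0 : E) (2 * ρ), q u (G' x) ∂μ)
        + 2 * ∫⁻ u in Metric.ball (0 : E) (2 * ρ), q u (G x) ∂μ := by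
    intro x
    have hm : ∀ y, Measurable fun u => q u y := fun y =>
      Measurable.of_uncurry_right (f := q) hqm
    have h1 : ∀ u, ‖φ (G' x) - φ (G x)‖ₑ ^ 2 ≤ 2 * q (u - τ x) (G' x) + 2 * q u (G x) := by
      intro u
      have e : Φ (u - τ x) (G' x) = Φ u (G x) := by rw [hGG', ← hadd, sub_add_cancel]
      simp only [hq, e]
      have h2 : ‖φ (G' x) - φ (G x)‖ ^ 2
          ≤ 2 * ‖φ (Φ u (G x)) - φ (G' x)‖ ^ 2 + 2 * ‖φ (Φ u (G x)) - φ (G x)‖ ^ 2 := by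
        have h3 : ‖φ (G' x) - φ (G x)‖
            ≤ ‖φ (Φ u (G x)) - φ (G' x)‖ + ‖φ (Φ u (G x)) - φ (G x)‖ := by
          calc _ = ‖(φ (Φ u (G x)) - φ (G x)) - (φ (Φ u (G x)) - φ (G' x))‖ := by
                congr 1; abel
            _ ≤ _ := norm_sub_le _ _
            _ = _ := add_comm _ _
        nlinarith [sq_nonneg (‖φ (Φ u (G x)) - φ (G' x)‖ - ‖φ (Φ u (G x)) - φ (G x)‖),
          norm_nonneg (φ (G' x) - φ (G x))]
      have h4 := ENNReal.ofReal_le_ofReal h2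
      rw [ENNReal.ofReal_add (by positivity) (by positivity), ENNReal.ofReal_mul (by norm_num),
        ENNReal.ofReal_mul (by norm_num), ENNReal.ofReal_pow (norm_nonneg _),
        ENNReal.ofReal_pow (norm_nonneg _), ENNReal.ofReal_pow (norm_nonneg _)] at h4
      simpa using h4
    have hms : Measurable fun u => q (u - τ x) (G' x) :=
      (hm (G' x)).comp (measurable_id.sub_const (τ x))
    have h5 : ∫⁻ u in Metric.ball (0 : E) ρ, q (u - τ x) (G' x) ∂μ
        ≤ ∫⁻ u in Metric.ball (0 : E) (2 * ρ), q u (G' x) ∂μ := by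
      rw [← lintegral_indicator measurableSet_ball, ← lintegral_indicator measurableSet_ball,
        ← lintegral_sub_right_eq_self
          (fun u => (Metric.ball (0 : E) (2 * ρ)).indicator (fun u => q u (G' x)) u) (τ x)]
      refine lintegral_mono fun u => ?_
      by_cases hu : u ∈ Metric.ball (0 : E) ρ
      · have hu' : u - τ x ∈ Metric.ball (0 : E) (2 * ρ) := by
          rw [mem_ball_zero_iff] at hu ⊢
          have := norm_sub_le u (τ x)
          have := hτ x
          linarith
        rw [Set.indicator_of_mem hu, Set.indicator_of_mem hu']
      · rw [Set.indicator_of_notMem hu]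
        exact zero_le
    have h6 : ∫⁻ u in Metric.ball (0 : E) ρ, q u (G x) ∂μ
        ≤ ∫⁻ u in Metric.ball (0 : E) (2 * ρ), q u (G x) ∂μ :=
      lintegral_mono_set (Metric.ball_subset_ball (by linarith))
    calc V * ‖φ (G' x) - φ (G x)‖ₑ ^ 2
        = ∫⁻ u in Metric.ball (0 : E) ρ, ‖φ (G' x) - φ (G x)‖ₑ ^ 2 ∂μ := by
          rw [setLIntegral_const, mul_comm]
      _ ≤ ∫⁻ u in Metric.ball (0 : E) ρ, (2 * q (u - τ x) (G' x) + 2 * q u (G x)) ∂μ :=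
          lintegral_mono fun u => h1 u
      _ = 2 * (∫⁻ u in Metric.ball (0 : E) ρ, q (u - τ x) (G' x) ∂μ)
          + 2 * ∫⁻ u in Metric.ball (0 : E) ρ, q u (G x) ∂μ := by
          rw [lintegral_add_right _ ((hm _).const_mul 2), lintegral_const_mul _ (hm _),
            lintegral_const_mul _ (hms : Measurable fun u => q (u - τ x) (G' x))]
      _ ≤ _ := by gcongr
  have hint : ∀ H : Ec d → Ec d, LipschitzWith (1 / 2) (fun x => H x - x) → Continuous H →
      ∫⁻ x, ∫⁻ u in Metric.ball (0 : E) (2 * ρ), q u (H x) ∂μ ≤ W * (2 ^ d * S) := by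
    intro H hH hHc
    rw [lintegral_lintegral_swap]
    · calc _ ≤ ∫⁻ u in Metric.ball (0 : E) (2 * ρ), 2 ^ d * S ∂μ := by
            refine setLIntegral_mono' measurableSet_ball fun u hu => ?_
            have hu' : ‖u‖ ≤ 2 * ρ := (mem_ball_zero_iff.1 hu).le
            refine (lintegral_comp_le hHc (map_volume_le hH)
              (Measurable.of_uncurry_left (f := q) hqm)).trans ?_
            gcongr
            simpa only [hq] using hS u hu'
        _ = _ := by rw [setLIntegral_const, mul_comm]
    · exact (hqm.comp (measurable_snd.prodMk (hHc.measurable.comp measurable_fst))).aemeasurable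
  have hmI : ∀ H : Ec d → Ec d, Continuous H → Measurable fun x =>
      ∫⁻ u in Metric.ball (0 : E) (2 * ρ), q u (H x) ∂μ := fun H hHc =>
    Measurable.lintegral_prod_right'
      (f := fun p : Ec d × E => q p.2 (H p.1))
      (hqm.comp (measurable_snd.prodMk (hHc.measurable.comp measurable_fst)))
  have htot : V * ∫⁻ x, ‖φ (G' x) - φ (G x)‖ₑ ^ 2
      ≤ V * (2 ^ (Module.finrank ℝ E + 2 + d) * S) := by
    calc V * ∫⁻ x, ‖φ (G' x) - φ (G x)‖ₑ ^ 2
        = ∫⁻ x, V * ‖φ (G' x) - φ (G x)‖ₑ ^ 2 := by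
          rw [lintegral_const_mul' _ _ hVt]
      _ ≤ ∫⁻ x, (2 * (∫⁻ u in Metric.ball (0 : E) (2 * ρ), q u (G' x) ∂μ)
        + 2 * ∫⁻ u in Metric.ball (0 : E) (2 * ρ), q u (G x) ∂μ) := lintegral_mono hpt
      _ = 2 * (∫⁻ x, ∫⁻ u in Metric.ball (0 : E) (2 * ρ), q u (G' x) ∂μ)
        + 2 * ∫⁻ x, ∫⁻ u in Metric.ball (0 : E) (2 * ρ), q u (G x) ∂μ := by
          rw [lintegral_add_right _ ((hmI G hc).const_mul 2), lintegral_const_mul _ (hmI G hc),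
            lintegral_const_mul _ (hmI G' hc')]
      _ ≤ 2 * (W * (2 ^ d * S)) + 2 * (W * (2 ^ d * S)) := by
          gcongr
          · exact hint G' hG' hc'
          · exact hint G hG hc
      _ = _ := by rw [hW]; ring
  exact (ENNReal.mul_le_mul_iff_right hV0 hVt).1 htot

lemma eLpNorm_displacement_le (μ : Measure E) [μ.IsAddHaarMeasure] {Φ : E → Ec d → Ec d}
    (hΦ : Continuous fun p : E × Ec d => Φ p.1 p.2)
    (hadd : ∀ u v x, Φ (u + v) x = Φ u (Φ v x)) {φ : Ec d → ℂ} (hφ : Continuous φ)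
    {G G' : Ec d → Ec d} (hG : LipschitzWith (1 / 2) fun x => G x - x)
    (hG' : LipschitzWith (1 / 2) fun x => G' x - x) {τ : Ec d → E} {ρ : ℝ} (hρ : 0 < ρ)
    (hτ : ∀ x, ‖τ x‖ ≤ ρ) (hGG' : ∀ x, G' x = Φ (τ x) (G x)) {B : ℝ≥0∞}
    (hB : ∀ u, ‖u‖ ≤ 2 * ρ → eLpNorm (fun y => φ (Φ u y) - φ y) 2 volume ≤ B) :
    eLpNorm (fun x => φ (G' x) - φ (G x)) 2 volume
      ≤ 2 ^ (Module.finrank ℝ E + 2 + d) * B := by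
  rw [eLpNorm_two_le_iff]
  refine (lintegral_displacement_le μ hΦ hadd hφ hG hG' hρ hτ hGG' (S := B ^ 2)
    fun u hu => (eLpNorm_two_le_iff _ _).1 (hB u hu)).trans ?_
  rw [mul_pow]
  refine mul_le_mul_left ?_ _
  exact le_self_pow₀ (one_le_pow₀ (one_le_two (α := ℝ≥0∞))) two_ne_zero

lemma eLpNorm_comp_le {G : Ec d → Ec d} (hG : LipschitzWith (1 / 2) fun x => G x - x)
    {g : Ec d → ℂ} (hg : Continuous g) :
    eLpNorm (fun x => g (G x)) 2 volume ≤ 2 ^ d * eLpNorm g 2 volume := by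
  have hc : Continuous G := continuous_of_lipschitz_sub_id hG
  rw [eLpNorm_two_le_iff, mul_pow, eLpNorm_two_sq]
  refine (lintegral_comp_le hc (map_volume_le hG) (g := fun x => ‖g x‖ₑ ^ 2)
    (hg.measurable.enorm.pow_const 2)).trans ?_
  refine mul_le_mul_left ?_ _
  exact le_self_pow₀ (one_le_pow₀ (one_le_two (α := ℝ≥0∞))) two_ne_zero

end Averaging

section Norms

open scoped ENNReal

lemma l2norm_eq_eLpNorm {f : Ec d → ℂ} (hf : Continuous f) :
    l2norm f = (eLpNorm f 2 volume).toReal := by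
  have h : ∫ x, ‖f x‖ ^ 2 = (eLpNorm f 2 volume).toReal ^ 2 := by
    rw [integral_eq_lintegral_of_nonneg_ae (f := fun x => ‖f x‖ ^ 2)
      (Filter.Eventually.of_forall fun x => sq_nonneg _)
      (hf.norm.pow 2).aestronglyMeasurable, ← ENNReal.toReal_pow, eLpNorm_two_sq]
    congr 1
    refine lintegral_congr fun x => ?_
    rw [ENNReal.ofReal_pow (norm_nonneg _), ofReal_norm]
  rw [l2norm, h, Real.sqrt_sq ENNReal.toReal_nonneg]

lemma l2norm_nonneg (f : Ec d → ℂ) : 0 ≤ l2norm f := Real.sqrt_nonneg _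

lemma IsCc.continuous {φ : Ec d → ℂ} (hφ : IsCc φ) : Continuous φ := hφ.1.continuous

lemma IsCc.eLpNorm_lt_top {φ : Ec d → ℂ} (hφ : IsCc φ) : eLpNorm φ 2 volume < ∞ :=
  (hφ.continuous.memLp_of_hasCompactSupport hφ.2).2

lemma IsCc.exists_displacement_bound {φ : Ec d → ℂ} (hφ : IsCc φ) {M : ℝ} (hM : 0 ≤ M) :
    ∃ C : ℝ, 0 ≤ C ∧ ∀ F : Ec d → Ec d, ∀ u : ℝ, 0 ≤ u → u ≤ 1 → (∀ x, ‖F x - x‖ ≤ M * u) →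
      eLpNorm (fun x => φ (F x) - φ x) 2 volume ≤ ENNReal.ofReal (C * u) := by
  obtain ⟨K, hK⟩ := hφ.1.lipschitzWith_of_hasCompactSupport hφ.2 (by simp)
  obtain ⟨R, hR⟩ := hφ.2.isCompact.isBounded.subset_closedBall (0 : Ec d)
  set s := Metric.closedBall (0 : Ec d) (R + M)
  have hs : volume s ^ (1 / (2 : ℝ≥0∞).toReal) ≠ ∞ :=
    (ENNReal.rpow_lt_top_of_nonneg (by positivity) measure_closedBall_lt_top.ne).ne
  refine ⟨K * M * (volume s ^ (1 / (2 : ℝ≥0∞).toReal)).toReal, by positivity,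
    fun F u hu hu1 hF => ?_⟩
  have hMu : M * u ≤ M := mul_le_of_le_one_right hM hu1
  have hpt : ∀ x, ‖φ (F x) - φ x‖ ≤ ‖s.indicator (fun _ => K * (M * u)) x‖ := by
    intro x
    by_cases hx : x ∈ s
    · rw [Set.indicator_of_mem hx, Real.norm_of_nonneg (by positivity)]
      refine (hK.norm_sub_le _ _).trans ?_
      gcongr
      exact hF x
    · have hx' : R + M < ‖x‖ := by simpa [s] using hx
      have h1 : φ x = 0 := image_eq_zero_of_notMem_tsupport fun h => by
        have := hR h
        rw [mem_closedBall_zero_iff] at this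
        linarith
      have h2 : φ (F x) = 0 := image_eq_zero_of_notMem_tsupport fun h => by
        have h3 := hR h
        rw [mem_closedBall_zero_iff] at h3
        have h4 := norm_sub_norm_le x (F x)
        rw [norm_sub_rev] at h4
        linarith [hF x]
      rw [h1, h2, sub_zero, norm_zero]
      exact norm_nonneg _
  calc eLpNorm (fun x => φ (F x) - φ x) 2 volume
      ≤ eLpNorm (s.indicator fun _ => K * (M * u)) 2 volume := eLpNorm_mono hpt
    _ = ‖(K * (M * u) : ℝ)‖ₑ * volume s ^ (1 / (2 : ℝ≥0∞).toReal) :=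
        eLpNorm_indicator_const measurableSet_closedBall (by simp) (by simp)
    _ = _ := by
        rw [Real.enorm_of_nonneg (by positivity), ← ENNReal.ofReal_toReal hs,
          ← ENNReal.ofReal_mul (by positivity)]
        rw [ENNReal.toReal_ofReal ENNReal.toReal_nonneg]
        congr 1
        ring

/-- A Hölder seminorm of a test function along a family of displacements is finite and controls
each displacement. -/
lemma eLpNorm_le_sSup {κ : Type*} {s : κ → ℝ} {F : κ → Ec d → Ec d} {M γ : ℝ} (hM : 0 ≤ M)
    (hγ1 : γ ≤ 1) (hs : ∀ i, 0 ≤ s i) (hF : ∀ i x, ‖F i x - x‖ ≤ M * s i)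
    (hFc : ∀ i, Continuous (F i)) {φ : Ec d → ℂ} (hφ : IsCc φ) {i : κ} (hi : s i ≤ 1) :
    eLpNorm (fun x => φ (F i x) - φ x) 2 volume ≤ ENNReal.ofReal (s i ^ γ *
      sSup ((fun i => s i ^ (-γ) * l2norm fun x => φ (F i x) - φ x) ''
        {i | 0 < s i ∧ s i ≤ 1})) := by
  have hc : ∀ i, Continuous fun x => φ (F i x) - φ x := fun i =>
    (hφ.continuous.comp (hFc i)).sub hφ.continuous
  obtain ⟨C, hC0, hC⟩ := hφ.exists_displacement_bound hM
  rcases (hs i).eq_or_lt with h0 | h0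
  · have h1 : (fun x => φ (F i x) - φ x) = 0 := by
      funext x
      have := hF i x
      rw [← h0, mul_zero, norm_le_zero_iff, sub_eq_zero] at this
      simp [this]
    rw [h1, eLpNorm_zero]
    exact zero_le
  · have hbdd : BddAbove ((fun i => s i ^ (-γ) * l2norm fun x => φ (F i x) - φ x) ''
        {i | 0 < s i ∧ s i ≤ 1}) := by
      refine ⟨C, ?_⟩
      rintro _ ⟨j, ⟨hj0, hj1⟩, rfl⟩
      have h1 : l2norm (fun x => φ (F j x) - φ x) ≤ C * s j := by
        rw [l2norm_eq_eLpNorm (hc j)]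
        exact ENNReal.toReal_le_of_le_ofReal (by positivity) (hC _ _ hj0.le hj1 (hF j))
      calc s j ^ (-γ) * l2norm (fun x => φ (F j x) - φ x) ≤ s j ^ (-γ) * (C * s j) := by gcongr
        _ = C * s j ^ (1 - γ) := by
            rw [sub_eq_neg_add, Real.rpow_add hj0, Real.rpow_one]; ring
        _ ≤ C * 1 := by
            gcongr
            exact Real.rpow_le_one hj0.le hj1 (by linarith)
        _ = C := mul_one C
    have hle := le_csSup hbdd ⟨i, ⟨h0, hi⟩, rfl⟩
    have hfin : eLpNorm (fun x => φ (F i x) - φ x) 2 volume ≠ ∞ :=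
      ((hC _ _ h0.le hi (hF i)).trans_lt ENNReal.ofReal_lt_top).ne
    rw [← ENNReal.ofReal_toReal hfin, ← l2norm_eq_eLpNorm (hc i)]
    refine ENNReal.ofReal_le_ofReal ?_
    calc l2norm (fun x => φ (F i x) - φ x)
        = s i ^ γ * (s i ^ (-γ) * l2norm (fun x => φ (F i x) - φ x)) := by
          rw [← mul_assoc, ← Real.rpow_add h0, add_neg_cancel, Real.rpow_zero, one_mul]
      _ ≤ _ := by gcongr

lemma sSup_holder_nonneg {κ : Type*} {s : κ → ℝ} (hs : ∀ i, 0 ≤ s i) (F : κ → Ec d → ℂ) (γ : ℝ)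
    (S : Set κ) : 0 ≤ sSup ((fun i => s i ^ (-γ) * l2norm (F i)) '' S) := by
  refine Real.sSup_nonneg ?_
  rintro _ ⟨i, -, rfl⟩
  exact mul_nonneg (Real.rpow_nonneg (hs i) _) (l2norm_nonneg _)

lemma vfHolder_nonneg (f : ℝ → Ec d → Ec d) (γ : ℝ) (φ : Ec d → ℂ) : 0 ≤ vfHolder f γ φ :=
  add_nonneg (l2norm_nonneg φ) (sSup_holder_nonneg (fun t : ℝ => abs_nonneg t) _ _ _)

lemma IsFlowOf.continuous {a : Ec d → Ec d} {f : ℝ → Ec d → Ec d} (hf : IsFlowOf a f) (t : ℝ) :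
    Continuous (f t) := hf.1.continuous.comp (Continuous.prodMk_right t)

lemma eLpNorm_flow_le_vfHolder {a : Ec d → Ec d} (ha : IsCbVF a) {f : ℝ → Ec d → Ec d}
    (hf : IsFlowOf a f) {γ : ℝ} (hγ1 : γ ≤ 1) {φ : Ec d → ℂ} (hφ : IsCc φ) {u : ℝ}
    (hu : |u| ≤ 1) :
    eLpNorm (fun x => φ (f u x) - φ x) 2 volume
      ≤ ENNReal.ofReal (|u| ^ γ * vfHolder f γ φ) := by
  obtain ⟨M, hM0, hM⟩ := BddSmooth.exists_bound (f := a) ha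
  refine (eLpNorm_le_sSup (s := fun t : ℝ => |t|) (F := f) hM0 hγ1 (fun t => abs_nonneg t)
    (fun t x => ?_) (fun t => hf.continuous t) hφ hu).trans ?_
  · simpa [hf.2.1] using flow_time_lipschitz hM hf.2.2 t 0 x
  · refine ENNReal.ofReal_le_ofReal ?_
    gcongr
    exact le_add_of_nonneg_left (l2norm_nonneg φ)

end Norms

section Controlled

open scoped ENNReal Topology
open Filter

/-- A family of perturbations of the identity, along which test functions are Hölder continuous
with constant proportional to `A`. -/
def IsControlled (A : (Ec d → ℂ) → ℝ) (γ : ℝ) (G : ℝ → Ec d → Ec d) : Prop :=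
  ∃ C : ℝ, 0 ≤ C ∧ ∀ᶠ s in 𝓝[>] (0 : ℝ),
    (∀ x y, ‖(G s x - x) - (G s y - y)‖ ≤ C * s * ‖x - y‖) ∧
    ∀ φ, IsCc φ → eLpNorm (fun x => φ (G s x) - φ x) 2 volume ≤ ENNReal.ofReal (C * s ^ γ * A φ)

lemma eventually_mul_le (C : ℝ) {ε : ℝ} (hε : 0 < ε) : ∀ᶠ s in 𝓝[>] (0 : ℝ), C * s ≤ ε := by
  have h : Tendsto (fun s : ℝ => C * s) (𝓝[>] 0) (𝓝 (C * 0)) :=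
    ((continuous_const.mul continuous_id).tendsto 0).mono_left nhdsWithin_le_nhds
  rw [mul_zero] at h
  exact (h.eventually (gt_mem_nhds hε)).mono fun _ h => le_of_lt h

lemma eventually_pos : ∀ᶠ s in 𝓝[>] (0 : ℝ), 0 < s := self_mem_nhdsWithin

lemma eventually_le_one : ∀ᶠ s in 𝓝[>] (0 : ℝ), s ≤ 1 := by
  simpa using eventually_mul_le 1 one_pos

lemma lipschitzWith_half {G : Ec d → Ec d} {K : ℝ} (hK : K ≤ 1 / 2)
    (h : ∀ x y, ‖(G x - x) - (G y - y)‖ ≤ K * ‖x - y‖) :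
    LipschitzWith (1 / 2) fun x => G x - x := by
  refine LipschitzWith.of_dist_le_mul fun x y => ?_
  rw [dist_eq_norm, dist_eq_norm]
  refine (h x y).trans ?_
  push_cast
  gcongr

lemma norm_sub_le_of_sub_id_le {G : Ec d → Ec d} {K : ℝ}
    (h : ∀ x y, ‖(G x - x) - (G y - y)‖ ≤ K * ‖x - y‖) (x y : Ec d) :
    ‖G x - G y‖ ≤ (1 + K) * ‖x - y‖ := by
  calc ‖G x - G y‖ = ‖((G x - x) - (G y - y)) + (x - y)‖ := by congr 1; abel
    _ ≤ _ := norm_add_le _ _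
    _ ≤ K * ‖x - y‖ + ‖x - y‖ := by gcongr; exact h x y
    _ = _ := by ring

lemma two_pow_mul_ofReal (n : ℕ) (x : ℝ) :
    2 ^ n * ENNReal.ofReal x = ENNReal.ofReal (2 ^ n * x) := by
  rw [ENNReal.ofReal_mul (by positivity), ENNReal.ofReal_pow (by norm_num)]
  simp

lemma eLpNorm_sub_sub_le {f g h : Ec d → ℂ} (hf : Continuous f) (hg : Continuous g)
    (hh : Continuous h) :
    eLpNorm (fun x => f x - h x) 2 volume
      ≤ eLpNorm (fun x => f x - g x) 2 volume + eLpNorm (fun x => g x - h x) 2 volume := by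
  have := eLpNorm_add_le (μ := (volume : Measure (Ec d))) (p := 2)
    (hf.sub hg).aestronglyMeasurable (hg.sub hh).aestronglyMeasurable (by norm_num)
  refine le_of_eq_of_le ?_ this
  congr 1
  funext x
  simp

variable {A : (Ec d → ℂ) → ℝ} {γ : ℝ}

lemma isControlled_id : IsControlled A γ fun _ (x : Ec d) => x :=
  ⟨0, le_rfl, Eventually.of_forall fun s => by simp⟩

lemma IsControlled.comp (hA : ∀ φ, IsCc φ → 0 ≤ A φ) {G G' : ℝ → Ec d → Ec d}
    (hG : IsControlled A γ G) (hG' : IsControlled A γ G') :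
    IsControlled A γ fun s x => G' s (G s x) := by
  obtain ⟨C, hC0, hC⟩ := hG
  obtain ⟨C', hC'0, hC'⟩ := hG'
  have hnn : 0 ≤ C' * (1 + C) + C + 2 ^ d * C' := by positivity
  refine ⟨C' * (1 + C) + C + 2 ^ d * C', hnn, ?_⟩
  filter_upwards [hC, hC', eventually_pos, eventually_le_one,
    eventually_mul_le C (show (0 : ℝ) < 1 / 2 by norm_num),
    eventually_mul_le C' (show (0 : ℝ) < 1 / 2 by norm_num)] with s h h' hs0 hs1 hCs hC's
  have hL := lipschitzWith_half hCs h.1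
  have hL' := lipschitzWith_half hC's h'.1
  have hc := continuous_of_lipschitz_sub_id hL
  have hc' := continuous_of_lipschitz_sub_id hL'
  refine ⟨fun x y => ?_, fun φ hφ => ?_⟩
  · have h1 : ‖G s x - G s y‖ ≤ (1 + C) * ‖x - y‖ := by
      refine (norm_sub_le_of_sub_id_le h.1 x y).trans ?_
      gcongr
      exact mul_le_of_le_one_right hC0 hs1
    calc ‖(G' s (G s x) - x) - (G' s (G s y) - y)‖
        = ‖((G' s (G s x) - G s x) - (G' s (G s y) - G s y))
            + ((G s x - x) - (G s y - y))‖ := by congr 1; abel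
      _ ≤ _ := norm_add_le _ _
      _ ≤ C' * s * ((1 + C) * ‖x - y‖) + C * s * ‖x - y‖ := by
        gcongr
        · exact (h'.1 _ _).trans (by gcongr)
        · exact h.1 x y
      _ = (C' * (1 + C) + C) * s * ‖x - y‖ := by ring
      _ ≤ _ := mul_le_mul_of_nonneg_right (mul_le_mul_of_nonneg_right
          (le_add_of_nonneg_right (by positivity)) hs0.le) (norm_nonneg _)
  · have hAφ := hA φ hφ
    calc eLpNorm (fun x => φ (G' s (G s x)) - φ x) 2 volume
        ≤ eLpNorm (fun x => φ (G' s (G s x)) - φ (G s x)) 2 volume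
          + eLpNorm (fun x => φ (G s x) - φ x) 2 volume :=
          eLpNorm_sub_sub_le (hφ.continuous.comp (hc'.comp hc)) (hφ.continuous.comp hc)
            hφ.continuous
      _ ≤ 2 ^ d * ENNReal.ofReal (C' * s ^ γ * A φ) + ENNReal.ofReal (C * s ^ γ * A φ) := by
          gcongr
          · exact (eLpNorm_comp_le hL (g := fun x => φ (G' s x) - φ x)
              ((hφ.continuous.comp hc').sub hφ.continuous)).trans
              (mul_le_mul_right (h'.2 φ hφ) _)
          · exact h.2 φ hφ
      _ ≤ _ := by
          rw [two_pow_mul_ofReal, ← ENNReal.ofReal_add (by positivity) (by positivity)]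
          refine ENNReal.ofReal_le_ofReal ?_
          calc 2 ^ d * (C' * s ^ γ * A φ) + C * s ^ γ * A φ
              = (C + 2 ^ d * C') * s ^ γ * A φ := by ring
            _ ≤ _ := by
              gcongr
              have : 0 ≤ C' * (1 + C) := by positivity
              linarith

/-- Following a controlled family by a flow for a position-dependent time. -/
lemma IsControlled.flow {a : Ec d → Ec d} (ha : IsCbVF a) {f : ℝ → Ec d → Ec d}
    (hf : IsFlowOf a f) (hγ0 : 0 < γ) (hA : ∀ φ, IsCc φ → 0 ≤ A φ)
    (hfA : ∀ φ, IsCc φ → ∀ u : ℝ, |u| ≤ 1 →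
      eLpNorm (fun x => φ (f u x) - φ x) 2 volume ≤ ENNReal.ofReal (|u| ^ γ * A φ))
    {G : ℝ → Ec d → Ec d} (hG : IsControlled A γ G) {τ : ℝ → Ec d → ℝ} {M L : ℝ} (hM : 0 < M)
    (hL : 0 ≤ L) (hτM : ∀ᶠ s in 𝓝[>] (0 : ℝ), ∀ x, |τ s x| ≤ M * s)
    (hτL : ∀ᶠ s in 𝓝[>] (0 : ℝ), ∀ x y, |τ s x - τ s y| ≤ L * s * ‖x - y‖) :
    IsControlled A γ fun s x => f (τ s x) (G s x) := by
  obtain ⟨C, hC0, hC⟩ := hG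
  obtain ⟨K, hK⟩ := BddSmooth.exists_lipschitz (f := a) ha
  obtain ⟨B, hB0, hB⟩ := BddSmooth.exists_bound (f := a) ha
  set P : ℝ := K * Real.exp K
  have hP0 : 0 ≤ P := by positivity
  set C₁ : ℝ := P * M * (1 + C) + B * L + C
  set C₂ : ℝ := 2 ^ (1 + 2 + d) * (2 * M) ^ γ + C
  have hC₁ : 0 ≤ C₁ := by positivity
  have hC₂ : 0 ≤ C₂ := by positivity
  refine ⟨C₁ + C₂, by positivity, ?_⟩
  filter_upwards [hC, hτM, hτL, eventually_pos, eventually_le_one,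
    eventually_mul_le C (show (0 : ℝ) < 1 / 2 by norm_num),
    eventually_mul_le C₁ (show (0 : ℝ) < 1 / 2 by norm_num),
    eventually_mul_le (2 * M) one_pos] with s h hτM hτL hs0 hs1 hCs hC₁s hMs
  have hτ1 : ∀ x, |τ s x| ≤ 1 := fun x => (hτM x).trans (by
    have : 0 ≤ M * s := by positivity
    linarith)
  have hlip : ∀ x y, ‖(f (τ s x) (G s x) - x) - (f (τ s y) (G s y) - y)‖
      ≤ C₁ * s * ‖x - y‖ := by
    intro x y
    have h1 : ‖G s x - G s y‖ ≤ (1 + C) * ‖x - y‖ := by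
      refine (norm_sub_le_of_sub_id_le h.1 x y).trans ?_
      gcongr
      exact mul_le_of_le_one_right hC0 hs1
    calc ‖(f (τ s x) (G s x) - x) - (f (τ s y) (G s y) - y)‖
        = ‖((f (τ s x) (G s x) - G s x) - (f (τ s x) (G s y) - G s y))
            + (f (τ s x) (G s y) - f (τ s y) (G s y)) + ((G s x - x) - (G s y - y))‖ := by
          congr 1; abel
      _ ≤ _ := norm_add₃_le
      _ ≤ P * (M * s) * ((1 + C) * ‖x - y‖) + B * (L * s * ‖x - y‖) + C * s * ‖x - y‖ := by
        gcongr
        · refine (flow_sub_id_lipschitz hK hf.2.1 hf.2.2 (hτ1 x) _ _).trans ?_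
          gcongr
          exact hτM x
        · refine (flow_time_lipschitz hB hf.2.2 _ _ _).trans ?_
          gcongr
          exact hτL x y
        · exact h.1 x y
      _ = C₁ * s * ‖x - y‖ := by simp only [C₁]; ring
  have hLG := lipschitzWith_half hCs h.1
  have hLG' := lipschitzWith_half (G := fun x => f (τ s x) (G s x)) hC₁s hlip
  refine ⟨fun x y => (hlip x y).trans ?_, fun φ hφ => ?_⟩
  · gcongr
    exact le_add_of_nonneg_right hC₂
  · have hAφ := hA φ hφ
    have hdisp := eLpNorm_displacement_le (E := ℝ) volume (Φ := f) hf.1.continuous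
      (flow_add hK hf.2.1 hf.2.2) hφ.continuous hLG hLG' (τ := τ s) (ρ := M * s) (by positivity)
      hτM (fun x => rfl) (B := ENNReal.ofReal ((2 * M * s) ^ γ * A φ)) (fun u hu => by
        have hu' : |u| ≤ 2 * M * s := by rw [Real.norm_eq_abs] at hu; linarith
        refine (hfA φ hφ u (hu'.trans hMs)).trans (ENNReal.ofReal_le_ofReal ?_)
        gcongr)
    calc eLpNorm (fun x => φ (f (τ s x) (G s x)) - φ x) 2 volume
        ≤ eLpNorm (fun x => φ (f (τ s x) (G s x)) - φ (G s x)) 2 volume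
          + eLpNorm (fun x => φ (G s x) - φ x) 2 volume :=
          eLpNorm_sub_sub_le (hφ.continuous.comp (continuous_of_lipschitz_sub_id hLG'))
            (hφ.continuous.comp (continuous_of_lipschitz_sub_id hLG)) hφ.continuous
      _ ≤ 2 ^ (1 + 2 + d) * ENNReal.ofReal ((2 * M * s) ^ γ * A φ)
          + ENNReal.ofReal (C * s ^ γ * A φ) := by
          gcongr
          · simpa using hdisp
          · exact h.2 φ hφ
      _ ≤ _ := by
          rw [two_pow_mul_ofReal, ← ENNReal.ofReal_add (by positivity) (by positivity)]
          refine ENNReal.ofReal_le_ofReal ?_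
          calc 2 ^ (1 + 2 + d) * ((2 * M * s) ^ γ * A φ) + C * s ^ γ * A φ
              = C₂ * s ^ γ * A φ := by
                rw [Real.mul_rpow (by positivity) hs0.le]; simp only [C₂]; ring
            _ ≤ _ := by
              gcongr
              exact le_add_of_nonneg_left hC₁

lemma isControlled_wordMap {ι : Type*} {X : ι → Ec d → Ec d} (hX : ∀ i, IsCbVF (X i))
    {f : ι → ℝ → Ec d → Ec d} (hf : ∀ i, IsFlowOf (X i) (f i)) (hγ0 : 0 < γ)
    (hA : ∀ φ, IsCc φ → 0 ≤ A φ)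
    (hfA : ∀ i, ∀ φ, IsCc φ → ∀ u : ℝ, |u| ≤ 1 →
      eLpNorm (fun x => φ (f i u x) - φ x) 2 volume ≤ ENNReal.ofReal (|u| ^ γ * A φ))
    {τ : ℝ → Ec d → ℝ} {M L : ℝ} (hM : 0 < M)
    (hL : 0 ≤ L) (hτM : ∀ᶠ s in 𝓝[>] (0 : ℝ), ∀ x, |τ s x| ≤ M * s)
    (hτL : ∀ᶠ s in 𝓝[>] (0 : ℝ), ∀ x y, |τ s x - τ s y| ≤ L * s * ‖x - y‖)
    (w : List (ι × Bool)) : IsControlled A γ fun s x => wordMap f w (τ s x) x := by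
  induction w with
  | nil => exact isControlled_id
  | cons l w ih =>
    refine ih.flow (hX l.1) (hf l.1) hγ0 hA (hfA l.1)
      (τ := fun s x => timeSign l.2 * τ s x) hM hL ?_ ?_
    · simpa only [abs_mul, abs_timeSign, one_mul] using hτM
    · simpa only [← mul_sub, abs_mul, abs_timeSign, one_mul] using hτL

end Controlled

section Generation

open scoped ENNReal Topology
open Filter

/-- Bounded Lipschitz functions. -/
def IsBddLip {F : Type*} [NormedAddCommGroup F] (b : Ec d → F) : Prop :=
  ∃ B K : ℝ, 0 ≤ B ∧ 0 ≤ K ∧ (∀ x, ‖b x‖ ≤ B) ∧ ∀ x y, ‖b x - b y‖ ≤ K * ‖x - y‖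

namespace IsBddLip

variable {F : Type*} [NormedAddCommGroup F]

lemma of_bddSmooth [NormedSpace ℝ F] {b : Ec d → F} (hb : BddSmooth b) : IsBddLip b := by
  obtain ⟨B, hB0, hB⟩ := hb.exists_bound
  obtain ⟨K, hK⟩ := hb.exists_lipschitz
  exact ⟨B, K, hB0, K.2, hB, hK.norm_sub_le⟩

lemma const (c : F) : IsBddLip fun _ : Ec d => c :=
  ⟨‖c‖, 0, norm_nonneg c, le_rfl, fun _ => le_rfl, fun _ _ => by simp⟩

lemma add {b b' : Ec d → F} (hb : IsBddLip b) (hb' : IsBddLip b') :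
    IsBddLip fun x => b x + b' x := by
  obtain ⟨B, K, hB0, hK0, hB, hK⟩ := hb
  obtain ⟨B', K', hB'0, hK'0, hB', hK'⟩ := hb'
  refine ⟨B + B', K + K', by positivity, by positivity,
    fun x => (norm_add_le _ _).trans (add_le_add (hB x) (hB' x)), fun x y => ?_⟩
  rw [add_sub_add_comm, add_mul]
  exact (norm_add_le _ _).trans (add_le_add (hK x y) (hK' x y))

lemma neg {b : Ec d → F} (hb : IsBddLip b) : IsBddLip fun x => -b x := by
  obtain ⟨B, K, hB0, hK0, hB, hK⟩ := hb
  refine ⟨B, K, hB0, hK0, fun x => by rw [norm_neg]; exact hB x, fun x y => ?_⟩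
  rw [neg_sub_neg, norm_sub_rev]
  exact hK x y

lemma smul [NormedSpace ℝ F] {g : Ec d → ℝ} {b : Ec d → F} (hg : IsBddLip g) (hb : IsBddLip b) :
    IsBddLip fun x => g x • b x := by
  obtain ⟨B, K, hB0, hK0, hB, hK⟩ := hb
  obtain ⟨B', K', hB'0, hK'0, hB', hK'⟩ := hg
  refine ⟨B' * B, B' * K + K' * B, by positivity, by positivity, fun x => ?_, fun x y => ?_⟩
  · rw [norm_smul]
    gcongr
    · exact hB' x
    · exact hB x
  · calc ‖g x • b x - g y • b y‖ = ‖g x • (b x - b y) + (g x - g y) • b y‖ := by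
          congr 1; rw [smul_sub, sub_smul]; abel
      _ ≤ ‖g x‖ * ‖b x - b y‖ + ‖g x - g y‖ * ‖b y‖ := by
          rw [← norm_smul, ← norm_smul]; exact norm_add_le _ _
      _ ≤ B' * (K * ‖x - y‖) + (K' * ‖x - y‖) * B := by
          gcongr
          · exact hB' x
          · exact hK x y
          · exact hK' x y
          · exact hB y
      _ = _ := by ring

end IsBddLip

/-- The vector field `b` is, to leading order `s ^ r`, the displacement of a controlled family. -/
def IsGenerated (A : (Ec d → ℂ) → ℝ) (γ : ℝ) (r : ℕ) (b : Ec d → Ec d) : Prop :=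
  ∃ G, IsControlled A γ G ∧ ∃ C : ℝ, 0 ≤ C ∧ ∀ᶠ s in 𝓝[>] (0 : ℝ),
    ∀ x, ‖G s x - x - s ^ r • b x‖ ≤ C * s ^ (r + 1)

variable {A : (Ec d → ℂ) → ℝ} {γ : ℝ} {r : ℕ}

lemma isGenerated_zero : IsGenerated A γ r fun _ : Ec d => 0 :=
  ⟨_, isControlled_id, 0, le_rfl, Eventually.of_forall fun s x => by simp⟩

lemma IsGenerated.add (hr : 1 ≤ r) (hA : ∀ φ, IsCc φ → 0 ≤ A φ) {b b' : Ec d → Ec d}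
    (hb : IsBddLip b) (hb' : IsBddLip b') (h : IsGenerated A γ r b) (h' : IsGenerated A γ r b') :
    IsGenerated A γ r fun x => b x + b' x := by
  obtain ⟨G, hG, C, hC0, hC⟩ := h
  obtain ⟨G', hG', C', hC'0, hC'⟩ := h'
  obtain ⟨B, -, hB0, -, hB, -⟩ := hb
  obtain ⟨-, K, -, hK0, -, hK⟩ := hb'
  refine ⟨_, hG.comp hA hG', C' + K * (B + C) + C, by positivity, ?_⟩
  filter_upwards [hC, hC', eventually_pos, eventually_le_one] with s hC hC' hs0 hs1 x
  have hsr : s ^ r ≤ s := pow_le_of_le_one hs0.le hs1 (by omega)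
  have h1 : ‖G s x - x‖ ≤ (B + C) * s := by
    calc ‖G s x - x‖ = ‖(G s x - x - s ^ r • b x) + s ^ r • b x‖ := by congr 1; abel
      _ ≤ _ := norm_add_le _ _
      _ ≤ C * s ^ (r + 1) + s ^ r * B := by
          gcongr
          · exact hC x
          · rw [norm_smul, Real.norm_of_nonneg (by positivity)]
            gcongr
            exact hB x
      _ ≤ C * s + s * B := by
          gcongr
          exact pow_le_of_le_one hs0.le hs1 (by omega)
      _ = _ := by ring
  calc ‖G' s (G s x) - x - s ^ r • (b x + b' x)‖
      = ‖(G' s (G s x) - G s x - s ^ r • b' (G s x)) + s ^ r • (b' (G s x) - b' x)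
          + (G s x - x - s ^ r • b x)‖ := by
        congr 1; rw [smul_add, smul_sub]; abel
    _ ≤ _ := norm_add₃_le
    _ ≤ C' * s ^ (r + 1) + s ^ r * (K * ((B + C) * s)) + C * s ^ (r + 1) := by
        gcongr
        · exact hC' _
        · rw [norm_smul, Real.norm_of_nonneg (by positivity)]
          gcongr
          exact (hK _ _).trans (by gcongr)
        · exact hC x
    _ = _ := by ring

lemma IsGenerated.sum (hr : 1 ≤ r) (hA : ∀ φ, IsCc φ → 0 ≤ A φ) {κ : Type*} (S : Finset κ)
    {b : κ → Ec d → Ec d} (hb : ∀ i ∈ S, IsBddLip (b i))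
    (h : ∀ i ∈ S, IsGenerated A γ r (b i)) :
    IsBddLip (fun x => ∑ i ∈ S, b i x) ∧ IsGenerated A γ r fun x => ∑ i ∈ S, b i x := by
  classical
  induction S using Finset.induction_on with
  | empty => simpa using ⟨IsBddLip.const 0, isGenerated_zero⟩
  | insert i S hi ih =>
    simp only [Finset.sum_insert hi]
    obtain ⟨h1, h2⟩ := ih (fun j hj => hb j (Finset.mem_insert_of_mem hj))
      (fun j hj => h j (Finset.mem_insert_of_mem hj))
    have h3 := hb i (Finset.mem_insert_self _ _)
    exact ⟨h3.add h1, IsGenerated.add hr hA h3 h1 (h i (Finset.mem_insert_self _ _)) h2⟩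

lemma abs_rpow_sub_rpow_le {x y p : ℝ} (hx : 1 ≤ x) (hy : 1 ≤ y) (hp0 : 0 ≤ p) (hp1 : p ≤ 1) :
    |x ^ p - y ^ p| ≤ |x - y| := by
  wlog hxy : y ≤ x generalizing x y
  · rw [abs_sub_comm, abs_sub_comm x]
    exact this hy hx (le_of_not_ge hxy)
  have hy0 : 0 < y := by linarith
  have h1 : x ^ p - y ^ p = y ^ p * ((x / y) ^ p - 1) := by
    rw [Real.div_rpow (by linarith) hy0.le]
    field_simp
  have hxy' : 1 ≤ x / y := (one_le_div hy0).2 hxy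
  have h2 : (x / y) ^ p ≤ x / y := by
    simpa using Real.rpow_le_rpow_of_exponent_le hxy' hp1
  have h3 : y ^ p ≤ y := by simpa using Real.rpow_le_rpow_of_exponent_le hy hp1
  rw [abs_of_nonneg (sub_nonneg.2 (Real.rpow_le_rpow hy0.le hxy hp0)),
    abs_of_nonneg (sub_nonneg.2 hxy), h1]
  calc y ^ p * ((x / y) ^ p - 1) ≤ y * (x / y - 1) := by
        gcongr
        exact sub_nonneg.2 (Real.one_le_rpow hxy' hp0)
    _ = x - y := by field_simp

variable {ι : Type*} {X : ι → Ec d → Ec d} {f : ι → ℝ → Ec d → Ec d}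

lemma isGenerated_of_wordMap (hX : ∀ i, IsCbVF (X i)) (hf : ∀ i, IsFlowOf (X i) (f i))
    (hγ0 : 0 < γ) (hA : ∀ φ, IsCc φ → 0 ≤ A φ)
    (hfA : ∀ i, ∀ φ, IsCc φ → ∀ u : ℝ, |u| ≤ 1 →
      eLpNorm (fun x => φ (f i u x) - φ x) 2 volume ≤ ENNReal.ofReal (|u| ^ γ * A φ))
    {k : ℕ} (hk : 1 ≤ k) (hkr : k ≤ r) {w : List (ι × Bool)} {b : Ec d → Ec d}
    (hw : ∃ C : ℝ, ∀ t : ℝ, |t| ≤ 1 → ∀ x, ‖wordMap f w t x - x - t ^ k • b x‖ ≤ C * |t| ^ (k + 1))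
    {g : Ec d → ℝ} (hg : IsBddLip g) (hg1 : ∀ x, 1 ≤ g x) :
    IsGenerated A γ r fun x => g x • b x := by
  obtain ⟨C, hC⟩ := hw
  obtain ⟨B, K, hB0, hK0, hB, hK⟩ := hg
  have hk0 : (0 : ℝ) < k := by exact_mod_cast hk
  have hk1 : (1 : ℝ) ≤ k := by exact_mod_cast hk
  have hp0 : (0 : ℝ) ≤ 1 / k := by positivity
  have hp1 : (1 : ℝ) / k ≤ 1 := (div_le_one hk0).2 hk1
  have hq : (1 : ℝ) ≤ r / k := (one_le_div hk0).2 (by exact_mod_cast hkr)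
  have hsq : ∀ s : ℝ, 0 < s → s ≤ 1 → s ^ ((r : ℝ) / k) ≤ s := fun s hs0 hs1 => by
    simpa using Real.rpow_le_rpow_of_exponent_ge hs0 hs1 hq
  have hgp : ∀ x, g x ^ ((1 : ℝ) / k) ≤ B + 1 := fun x => by
    have h1 : g x ^ ((1 : ℝ) / k) ≤ g x := by
      simpa using Real.rpow_le_rpow_of_exponent_le (hg1 x) hp1
    have h2 := (le_abs_self _).trans (hB x)
    linarith
  have hgp0 : ∀ x, 0 ≤ g x ^ ((1 : ℝ) / k) := fun x => Real.rpow_nonneg (by linarith [hg1 x]) _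
  have hτ : ∀ s : ℝ, 0 < s → s ≤ 1 → ∀ x,
      |s ^ ((r : ℝ) / k) * g x ^ ((1 : ℝ) / k)| ≤ (B + 1) * s := fun s hs0 hs1 x => by
    rw [abs_of_nonneg (mul_nonneg (by positivity) (hgp0 x)), mul_comm]
    exact mul_le_mul (hgp x) (hsq s hs0 hs1) (by positivity) (by positivity)
  have hτk : ∀ s : ℝ, 0 < s → ∀ x,
      (s ^ ((r : ℝ) / k) * g x ^ ((1 : ℝ) / k)) ^ k = s ^ r * g x := fun s hs0 x => by
    have hgx : 0 ≤ g x := by linarith [hg1 x]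
    rw [mul_pow, ← Real.rpow_mul_natCast hs0.le, ← Real.rpow_mul_natCast hgx,
      div_mul_cancel₀ _ hk0.ne', div_mul_cancel₀ _ hk0.ne', Real.rpow_natCast, Real.rpow_one]
  refine ⟨fun s x => wordMap f w (s ^ ((r : ℝ) / k) * g x ^ ((1 : ℝ) / k)) x,
    isControlled_wordMap hX hf hγ0 hA hfA (M := B + 1) (L := K) (by positivity) hK0 ?_ ?_ w,
    |C| * (B * (B + 1)), by positivity, ?_⟩
  · filter_upwards [eventually_pos, eventually_le_one] with s hs0 hs1 x using hτ s hs0 hs1 x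
  · filter_upwards [eventually_pos, eventually_le_one] with s hs0 hs1 x y
    rw [← mul_sub, abs_mul, abs_of_nonneg (by positivity)]
    calc s ^ ((r : ℝ) / k) * |g x ^ ((1 : ℝ) / k) - g y ^ ((1 : ℝ) / k)|
        ≤ s * (K * ‖x - y‖) := by
          gcongr
          · exact hsq s hs0 hs1
          · exact (abs_rpow_sub_rpow_le (hg1 x) (hg1 y) hp0 hp1).trans (hK x y)
      _ = _ := by ring
  · filter_upwards [eventually_pos, eventually_le_one,
      eventually_mul_le (B + 1) one_pos] with s hs0 hs1 hBs x
    have h1 := hC _ ((hτ s hs0 hs1 x).trans hBs) x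
    rw [hτk s hs0, mul_smul] at h1
    refine h1.trans ?_
    rw [pow_succ, ← abs_pow, hτk s hs0, abs_mul, abs_of_pos (by positivity : 0 < s ^ r)]
    calc C * (s ^ r * |g x| * |s ^ ((r : ℝ) / k) * g x ^ ((1 : ℝ) / k)|)
        ≤ |C| * (s ^ r * B * ((B + 1) * s)) := by
          gcongr
          · exact le_abs_self C
          · exact hB x
          · exact hτ s hs0 hs1 x
      _ = _ := by ring

/-- Multiples of iterated commutators by bounded smooth functions are generated. -/
lemma isGenerated_smul_multiComm (hr : 1 ≤ r) (hX : ∀ i, IsCbVF (X i))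
    (hf : ∀ i, IsFlowOf (X i) (f i))
    (hγ0 : 0 < γ) (hA : ∀ φ, IsCc φ → 0 ≤ A φ)
    (hfA : ∀ i, ∀ φ, IsCc φ → ∀ u : ℝ, |u| ≤ 1 →
      eLpNorm (fun x => φ (f i u x) - φ x) 2 volume ≤ ENNReal.ofReal (|u| ^ γ * A φ))
    {l : List ι} (hl : 1 ≤ l.length) (hlr : l.length ≤ r) {ψ : Ec d → ℝ} (hψ : IsCbR ψ) :
    IsBddLip (fun x => ψ x • multiComm X l x) ∧
      IsGenerated A γ r fun x => ψ x • multiComm X l x := by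
  have hX' : ∀ i, BddSmooth (X i) := hX
  have hψ' : IsBddLip ψ := .of_bddSmooth hψ
  have hY : IsBddLip (multiComm X l) := .of_bddSmooth (BddSmooth.multiComm hX' l)
  have hl0 : l ≠ [] := List.ne_nil_of_length_pos hl
  have hexp := hasExpansion_wordMap hX' (fun i x => (hf i).2.1 x) (fun i => (hf i).2.2)
  have hlead := wordSeries_commWord hX' l hl0
  have hpos := (hexp (commWord l)).exists_bound hl hlead (fun x => vfOp_tameId _ _ x)
  have hneg := (hexp (invWord (commWord l))).exists_bound (b := fun x => -multiComm X l x) hl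
    (hlead.inv hl (wordSeries_invWord _ _).1) (fun x => by
      rw [← vfOp_tameId _ (BddSmooth.multiComm hX' l) x]; rfl)
  obtain ⟨B, -, hB0, -, hB, -⟩ := IsBddLip.of_bddSmooth (b := ψ) hψ
  have hg : IsBddLip fun x => ψ x + (B + 1) := hψ'.add (.const _)
  have h1 := isGenerated_of_wordMap hX hf hγ0 hA hfA hl hlr hpos hg fun x => by
    linarith [(abs_le.1 (hB x)).1]
  have h2 := isGenerated_of_wordMap hX hf hγ0 hA hfA hl hlr hneg (IsBddLip.const (B + 1))
    fun x => by linarith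
  have h3 := h1.add hr hA (hg.smul hY) ((IsBddLip.const (B + 1)).smul hY.neg) h2
  refine ⟨hψ'.smul hY, ?_⟩
  convert h3 using 2 with x
  rw [add_smul, smul_neg]
  abel

/-- Under the uniform Hörmander condition every `C_b^∞`-vector field is generated. -/
lemma UniformHormander.isGenerated {N : ℕ} {X : Fin N → Ec d → Ec d}
    {f : Fin N → ℝ → Ec d → Ec d} (hUH : UniformHormander X r) (hr : 1 ≤ r)
    (hX : ∀ i, IsCbVF (X i)) (hf : ∀ i, IsFlowOf (X i) (f i))
    (hγ0 : 0 < γ) (hA : ∀ φ, IsCc φ → 0 ≤ A φ)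
    (hfA : ∀ i, ∀ φ, IsCc φ → ∀ u : ℝ, |u| ≤ 1 →
      eLpNorm (fun x => φ (f i u x) - φ x) 2 volume ≤ ENNReal.ofReal (|u| ^ γ * A φ))
    {a : Ec d → Ec d} (ha : IsCbVF a) : IsGenerated A γ r a := by
  obtain ⟨ψ, hψ, hsum⟩ := hUH a ha
  rw [show a = _ from funext hsum]
  have h : ∀ k ∈ Finset.Icc 1 r, ∀ v : Fin k → Fin N,
      IsBddLip (fun x => ψ (List.ofFn v) x • multiComm X (List.ofFn v) x) ∧
        IsGenerated A γ r fun x => ψ (List.ofFn v) x • multiComm X (List.ofFn v) x := by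
    intro k hk v
    rw [Finset.mem_Icc] at hk
    exact isGenerated_smul_multiComm hr hX hf hγ0 hA hfA (by simpa using hk.1)
      (by simpa using hk.2) (hψ _)
  have h' := fun k hk => IsGenerated.sum hr hA Finset.univ
    (fun v _ => (h k hk v).1) (fun v _ => (h k hk v).2)
  exact (IsGenerated.sum hr hA _ (fun k hk => (h' k hk).1) (fun k hk => (h' k hk).2)).2

end Generation

section Translations

open scoped ENNReal Topology
open Filter

lemma bddSmooth_const (e : Ec d) : BddSmooth fun _ : Ec d => e := by
  refine ⟨contDiff_const, fun n => ⟨‖e‖, fun x => ?_⟩⟩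
  rcases Nat.eq_zero_or_pos n with rfl | hn
  · simp
  · rw [iteratedFDeriv_const_of_ne hn.ne']
    simp

lemma eLpNorm_translate {g : Ec d → ℂ} (hg : Continuous g) (v : Ec d) :
    eLpNorm (fun x => g (x + v)) 2 volume = eLpNorm g 2 volume :=
  eLpNorm_comp_measurePreserving hg.aestronglyMeasurable (measurePreserving_add_right volume v)

lemma eLpNorm_translate_sub_le {φ : Ec d → ℂ} (hφ : Continuous φ) (v : Ec d) :
    eLpNorm (fun x => φ (x + v) - φ x) 2 volume ≤ 2 * eLpNorm φ 2 volume := by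
  have hv : Continuous fun x => φ (x + v) := hφ.comp (continuous_id.add continuous_const)
  have := eLpNorm_sub_le (μ := (volume : Measure (Ec d))) (p := 2)
    hv.aestronglyMeasurable hφ.aestronglyMeasurable (by norm_num)
  rw [eLpNorm_translate hφ, ← two_mul] at this
  exact this

lemma eLpNorm_translate_sum_le {φ : Ec d → ℂ} (hφ : Continuous φ) {κ : Type*} (S : Finset κ)
    (v : κ → Ec d) :
    eLpNorm (fun x => φ (x + ∑ k ∈ S, v k) - φ x) 2 volume
      ≤ ∑ k ∈ S, eLpNorm (fun x => φ (x + v k) - φ x) 2 volume := by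
  classical
  have hc : ∀ w : Ec d, Continuous fun x => φ (x + w) := fun w =>
    hφ.comp (continuous_id.add continuous_const)
  induction S using Finset.induction_on with
  | empty => simp
  | insert i S hi ih =>
    rw [Finset.sum_insert hi, Finset.sum_insert hi]
    set w := ∑ k ∈ S, v k
    refine (eLpNorm_sub_sub_le (hc _) (hc w) hφ).trans (add_le_add (le_of_eq ?_) ih)
    rw [← eLpNorm_translate (g := fun x => φ (x + v i) - φ x) ((hc (v i)).sub hφ) w]
    congr 1
    funext x
    rw [add_comm (v i), add_assoc]

variable {A H : (Ec d → ℂ) → ℝ} {γ : ℝ} {r : ℕ}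

/-- Translation along a constant generated vector field. -/
lemma IsGenerated.translate (hr : 1 ≤ r) (hγ0 : 0 < γ) (hA : ∀ φ, IsCc φ → 0 ≤ A φ)
    (hH : ∀ φ, IsCc φ → 0 ≤ H φ)
    (hmH : ∀ φ, IsCc φ → ∀ z : Ec d, ‖z‖ ≤ 1 →
      eLpNorm (fun x => φ (x - z) - φ x) 2 volume ≤ ENNReal.ofReal (‖z‖ ^ (γ / r) * H φ))
    {e : Ec d} (he : IsGenerated A γ r fun _ => e) :
    ∃ C : ℝ, 0 ≤ C ∧ ∀ᶠ s in 𝓝[>] (0 : ℝ), ∀ φ, IsCc φ →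
      eLpNorm (fun x => φ (x + s ^ r • e) - φ x) 2 volume
        ≤ ENNReal.ofReal (C * s ^ γ * (A φ + s ^ (γ / r) * H φ)) := by
  obtain ⟨G, ⟨C, hC0, hC⟩, D, hD0, hD⟩ := he
  have hr0 : (0 : ℝ) < r := by exact_mod_cast hr
  set P : ℝ := 2 ^ (d + 2 + d) * (2 * (D + 1)) ^ (γ / r)
  have hP0 : 0 ≤ P := by positivity
  refine ⟨C + P, by positivity, ?_⟩
  filter_upwards [hC, hD, eventually_pos, eventually_le_one,
    eventually_mul_le C (show (0 : ℝ) < 1 / 2 by norm_num),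
    eventually_mul_le (2 * (D + 1)) one_pos] with s hC hD hs0 hs1 hCs hDs φ hφ
  have hAφ := hA φ hφ
  have hHφ := hH φ hφ
  have hL := lipschitzWith_half hCs hC.1
  have hL' := lipschitzWith_half (G := fun x : Ec d => x + s ^ r • e) (K := 0) (by norm_num)
    (fun x y => by simp)
  have hρ1 : 2 * ((D + 1) * s ^ (r + 1)) ≤ 1 := by
    have h1 : s ^ (r + 1) ≤ s := pow_le_of_le_one hs0.le hs1 (by omega)
    calc 2 * ((D + 1) * s ^ (r + 1)) ≤ 2 * ((D + 1) * s) := by gcongr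
      _ = 2 * (D + 1) * s := by ring
      _ ≤ 1 := hDs
  have hdisp := eLpNorm_displacement_le (E := Ec d) volume (Φ := fun u y => y - u)
    (continuous_snd.sub continuous_fst) (fun u v x => by rw [add_comm, sub_sub])
    hφ.continuous hL hL' (τ := fun x => G s x - x - s ^ r • e) (ρ := (D + 1) * s ^ (r + 1))
    (by positivity) (fun x => (hD x).trans (by gcongr; linarith)) (fun x => by abel)
    (B := ENNReal.ofReal ((2 * ((D + 1) * s ^ (r + 1))) ^ (γ / r) * H φ)) (fun u hu =>
      (hmH φ hφ u (hu.trans hρ1)).trans (ENNReal.ofReal_le_ofReal (by gcongr)))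
  have hpow : (2 * ((D + 1) * s ^ (r + 1))) ^ (γ / r)
      = (2 * (D + 1)) ^ (γ / r) * (s ^ γ * s ^ (γ / r)) := by
    rw [← mul_assoc, Real.mul_rpow (by positivity) (by positivity), ← Real.rpow_natCast,
      ← Real.rpow_mul hs0.le, ← Real.rpow_add hs0]
    congr 2
    push_cast
    field_simp
  rw [hpow, two_pow_mul_ofReal] at hdisp
  calc eLpNorm (fun x => φ (x + s ^ r • e) - φ x) 2 volume
      ≤ eLpNorm (fun x => φ (x + s ^ r • e) - φ (G s x)) 2 volume
        + eLpNorm (fun x => φ (G s x) - φ x) 2 volume :=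
        eLpNorm_sub_sub_le (hφ.continuous.comp (continuous_of_lipschitz_sub_id hL'))
          (hφ.continuous.comp (continuous_of_lipschitz_sub_id hL)) hφ.continuous
    _ ≤ _ := add_le_add hdisp (hC.2 φ hφ)
    _ = ENNReal.ofReal (P * s ^ γ * (s ^ (γ / r) * H φ) + C * s ^ γ * A φ) := by
        rw [← ENNReal.ofReal_add (by positivity) (by positivity)]
        congr 2
        simp only [P, finrank_euclideanSpace, Fintype.card_fin]
        ring
    _ ≤ _ := by
        refine ENNReal.ofReal_le_ofReal ?_
        have h1 : 0 ≤ P * s ^ γ * A φ := by positivity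
        have h2 : 0 ≤ C * s ^ γ * (s ^ (γ / r) * H φ) := by positivity
        linarith [h1, h2]

/-- Small translations, when all constant vector fields are generated. -/
lemma exists_translate_bound (hr : 1 ≤ r) (hγ0 : 0 < γ) (hA : ∀ φ, IsCc φ → 0 ≤ A φ)
    (hH : ∀ φ, IsCc φ → 0 ≤ H φ)
    (hmH : ∀ φ, IsCc φ → ∀ z : Ec d, ‖z‖ ≤ 1 →
      eLpNorm (fun x => φ (x - z) - φ x) 2 volume ≤ ENNReal.ofReal (‖z‖ ^ (γ / r) * H φ))
    (he : ∀ e : Ec d, IsGenerated A γ r fun _ => e) :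
    ∃ C : ℝ, 0 ≤ C ∧ ∃ δ : ℝ, 0 < δ ∧ ∀ φ, IsCc φ → ∀ z : Ec d, ‖z‖ < δ →
      eLpNorm (fun x => φ (x + z) - φ x) 2 volume
        ≤ ENNReal.ofReal (C * ‖z‖ ^ (γ / r) * (A φ + ‖z‖ ^ (γ / r / r) * H φ)) := by
  have hr0 : (0 : ℝ) < r := by exact_mod_cast hr
  choose C hC0 hC using fun p : Fin d × Bool =>
    (he (EuclideanSpace.single p.1 (timeSign p.2))).translate hr hγ0 hA hH hmH
  have hall := eventually_all.2 hC
  rw [eventually_nhdsWithin_iff, Metric.eventually_nhds_iff] at hall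
  obtain ⟨ε, hε, hall⟩ := hall
  have hCs : 0 ≤ ∑ p, C p := Finset.sum_nonneg fun p _ => hC0 p
  refine ⟨d * ∑ p, C p, by positivity, ε ^ r, by positivity, fun φ hφ z hz => ?_⟩
  have hAφ := hA φ hφ
  have hHφ := hH φ hφ
  set T : ℝ := (∑ p, C p) * ‖z‖ ^ (γ / r) * (A φ + ‖z‖ ^ (γ / r / r) * H φ)
  have hT : 0 ≤ T := by positivity
  have hcoord : ∀ k, eLpNorm (fun x => φ (x + EuclideanSpace.single k (z k)) - φ x) 2 volume
      ≤ ENNReal.ofReal T := by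
    intro k
    rcases eq_or_ne (z k) 0 with h0 | h0
    · have : (EuclideanSpace.single k (z k) : Ec d) = 0 := by rw [h0]; simp
      simp [this]
    · have hpos : 0 < |z k| := abs_pos.2 h0
      have hzk : |z k| ≤ ‖z‖ := by simpa using PiLp.norm_apply_le z k
      obtain ⟨b, hb⟩ : ∃ b, z k = |z k| * timeSign b := by
        rcases le_total 0 (z k) with h | h
        · exact ⟨true, by simp [timeSign, abs_of_nonneg h]⟩
        · exact ⟨false, by simp [timeSign, abs_of_nonpos h]⟩
      set s : ℝ := |z k| ^ ((1 : ℝ) / r)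
      have hs0 : 0 < s := Real.rpow_pos_of_pos hpos _
      have hsr : s ^ r = |z k| := by
        rw [← Real.rpow_mul_natCast hpos.le, div_mul_cancel₀ _ hr0.ne', Real.rpow_one]
      have hsε : s < ε := by
        refine lt_of_pow_lt_pow_left₀ r hε.le ?_
        rw [hsr]
        exact hzk.trans_lt hz
      have hsp : ∀ p : ℝ, s ^ p = |z k| ^ (p / r) := fun p => by
        rw [← Real.rpow_mul hpos.le, one_div, inv_mul_eq_div]
      have hsingle : (EuclideanSpace.single k (z k) : Ec d)
          = s ^ r • EuclideanSpace.single k (timeSign b) := by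
        rw [hsr]
        ext j
        by_cases hj : j = k
        · subst hj
          simpa using hb
        · simp [hj]
      have h1 := hall (y := s) (by simpa [abs_of_pos hs0] using hsε) hs0 (k, b) φ hφ
      rw [hsingle]
      refine h1.trans (ENNReal.ofReal_le_ofReal ?_)
      rw [hsp, hsp]
      have hCp : C (k, b) ≤ ∑ p, C p :=
        Finset.single_le_sum (fun p _ => hC0 p) (Finset.mem_univ _)
      have := hC0 (k, b)
      simp only [T]
      gcongr
  have hz' : z = ∑ k, EuclideanSpace.single k (z k) := by
    ext j
    simp [Finset.sum_apply, Pi.single_apply]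
  calc eLpNorm (fun x => φ (x + z) - φ x) 2 volume
      = eLpNorm (fun x => φ (x + ∑ k, EuclideanSpace.single k (z k)) - φ x) 2 volume := by
        rw [← hz']
    _ ≤ _ := eLpNorm_translate_sum_le hφ.continuous _ _
    _ ≤ ∑ _k : Fin d, ENNReal.ofReal T := Finset.sum_le_sum fun k _ => hcoord k
    _ = ENNReal.ofReal (d * T) := by
        rw [Finset.sum_const, Finset.card_univ, Fintype.card_fin, nsmul_eq_mul,
          ENNReal.ofReal_mul (Nat.cast_nonneg d), ENNReal.ofReal_natCast]
    _ = _ := by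
        congr 1
        simp only [T]
        ring

end Translations

/-- **Proposition 4.7 of ter Elst–Robinson, "Uniform subellipticity".**
Let `X₁,…,X_N` be `C_b^∞`-vector fields on `ℝ^d` satisfying the uniform Hörmander
condition of order `r`, and let `γ ∈ (0,1]`.  Then there is a `c > 0` with
`‖φ‖_{2;γ/r} ≤ c (∑_{j=1}^N ‖φ‖_{2;X_j,γ} + ‖φ‖₂)` for all `φ ∈ C_c^∞(ℝ^d)`. -/
theorem universal_holder_bound_of_hormander (d N r : ℕ) (hr : 1 ≤ r)
    (X : Fin N → Ec d → Ec d) (hX : ∀ i, IsCbVF (X i))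
    (hUH : UniformHormander X r)
    (fX : Fin N → ℝ → Ec d → Ec d) (hfX : ∀ i, IsFlowOf (X i) (fX i))
    (γ : ℝ) (hγ0 : 0 < γ) (hγ1 : γ ≤ 1) :
    ∃ c : ℝ, 0 < c ∧ ∀ φ : Ec d → ℂ, IsCc φ →
      uHolder (γ / r) φ ≤ c * ((∑ j, vfHolder (fX j) γ φ) + l2norm φ) := by
  have hr1 : (1 : ℝ) ≤ r := by exact_mod_cast hr
  have hr0 : (0 : ℝ) < r := by linarith
  have hσ0 : 0 < γ / r := by positivity
  have hσ1 : γ / r ≤ 1 := (div_le_one hr0).2 (hγ1.trans hr1)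
  set A : (Ec d → ℂ) → ℝ := fun φ => (∑ j, vfHolder (fX j) γ φ) + l2norm φ
  set H : (Ec d → ℂ) → ℝ := fun φ =>
    sSup ((fun z : Ec d => ‖z‖ ^ (-(γ / r)) * l2norm fun x => φ (x - z) - φ x) ''
      {z : Ec d | 0 < ‖z‖ ∧ ‖z‖ ≤ 1})
  have hsum : ∀ φ, 0 ≤ ∑ j, vfHolder (fX j) γ φ := fun φ =>
    Finset.sum_nonneg fun j _ => vfHolder_nonneg _ _ _
  have hA : ∀ φ, IsCc φ → 0 ≤ A φ := fun φ _ => add_nonneg (hsum φ) (l2norm_nonneg φ)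
  have hH : ∀ φ, IsCc φ → 0 ≤ H φ := fun φ _ =>
    sSup_holder_nonneg (fun z : Ec d => norm_nonneg z) _ _ _
  have hfA : ∀ i, ∀ φ, IsCc φ → ∀ u : ℝ, |u| ≤ 1 →
      eLpNorm (fun x => φ (fX i u x) - φ x) 2 volume ≤ ENNReal.ofReal (|u| ^ γ * A φ) := by
    intro i φ hφ u hu
    refine (eLpNorm_flow_le_vfHolder (hX i) (hfX i) hγ1 hφ hu).trans
      (ENNReal.ofReal_le_ofReal ?_)
    gcongr
    exact (Finset.single_le_sum (fun j _ => vfHolder_nonneg (fX j) γ φ)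
      (Finset.mem_univ i)).trans (le_add_of_nonneg_right (l2norm_nonneg φ))
  have hmH : ∀ φ, IsCc φ → ∀ z : Ec d, ‖z‖ ≤ 1 →
      eLpNorm (fun x => φ (x - z) - φ x) 2 volume ≤ ENNReal.ofReal (‖z‖ ^ (γ / r) * H φ) :=
    fun φ hφ z hz => eLpNorm_le_sSup (s := fun z : Ec d => ‖z‖) (F := fun z x => x - z)
      zero_le_one hσ1 (fun z => norm_nonneg z) (fun z x => by simp)
      (fun z => continuous_id.sub continuous_const) hφ hz
  obtain ⟨C, hC0, δ, hδ0, hC⟩ := exists_translate_bound hr hγ0 hA hH hmH fun e =>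
    hUH.isGenerated hr hX hfX hγ0 hA hfA (bddSmooth_const e)
  obtain ⟨η, hη0, hηδ, hη⟩ : ∃ η : ℝ, 0 < η ∧ η ≤ δ ∧ C * η ^ (γ / r / r) ≤ 1 / 2 := by
    have h1 : Filter.Tendsto (fun η : ℝ => C * η ^ (γ / r / r)) (nhdsWithin 0 (Set.Ioi 0))
        (nhds (C * 0 ^ (γ / r / r))) :=
      ((continuous_const.mul (Real.continuous_rpow_const (by positivity))).tendsto 0).mono_left
        nhdsWithin_le_nhds
    rw [Real.zero_rpow (by positivity), mul_zero] at h1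
    obtain ⟨η, h2, h3, h4⟩ := ((h1.eventually (gt_mem_nhds (show (0 : ℝ) < 1 / 2 by norm_num))).and
      (eventually_pos.and (eventually_mul_le 1 hδ0))).exists
    exact ⟨η, h3, by simpa using h4, h2.le⟩
  refine ⟨1 + 2 * (C + 2 * η ^ (-(γ / r))), by positivity, fun φ hφ => ?_⟩
  have hAφ := hA φ hφ
  have hHφ := hH φ hφ
  have hl2 : l2norm φ ≤ A φ := le_add_of_nonneg_left (hsum φ)
  have hkey : H φ ≤ C * A φ + 2 * η ^ (-(γ / r)) * A φ + 1 / 2 * H φ := by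
    refine Real.sSup_le ?_ (by positivity)
    rintro _ ⟨z, ⟨hz0, -⟩, rfl⟩
    have hcont : Continuous fun x => φ (x - z) - φ x :=
      (hφ.continuous.comp (continuous_id.sub continuous_const)).sub hφ.continuous
    simp only
    rw [l2norm_eq_eLpNorm hcont]
    simp only [sub_eq_add_neg _ z]
    rcases lt_or_ge ‖z‖ η with hz | hz
    · have h1 := hC φ hφ (-z) (by rw [norm_neg]; exact hz.trans_le hηδ)
      rw [norm_neg] at h1
      have h2 := ENNReal.toReal_le_of_le_ofReal (by positivity) h1
      calc ‖z‖ ^ (-(γ / r)) * (eLpNorm (fun x => φ (x + -z) - φ x) 2 volume).toReal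
          ≤ ‖z‖ ^ (-(γ / r)) * (C * ‖z‖ ^ (γ / r) * (A φ + ‖z‖ ^ (γ / r / r) * H φ)) := by
            gcongr
        _ = C * A φ + C * ‖z‖ ^ (γ / r / r) * H φ := by
            have h3 : ‖z‖ ^ (-(γ / r)) * ‖z‖ ^ (γ / r) = 1 := by
              rw [← Real.rpow_add hz0, neg_add_cancel, Real.rpow_zero]
            linear_combination (C * (A φ + ‖z‖ ^ (γ / r / r) * H φ)) * h3
        _ ≤ C * A φ + C * η ^ (γ / r / r) * H φ := by gcongr
        _ ≤ C * A φ + 1 / 2 * H φ := by gcongr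
        _ ≤ _ := by
            have : 0 ≤ 2 * η ^ (-(γ / r)) * A φ := by positivity
            linarith
    · have h1 : (eLpNorm (fun x => φ (x + -z) - φ x) 2 volume).toReal ≤ 2 * l2norm φ := by
        rw [l2norm_eq_eLpNorm hφ.continuous]
        have := ENNReal.toReal_mono (ENNReal.mul_ne_top (by simp) hφ.eLpNorm_lt_top.ne)
          (eLpNorm_translate_sub_le hφ.continuous (-z))
        simpa using this
      calc ‖z‖ ^ (-(γ / r)) * (eLpNorm (fun x => φ (x + -z) - φ x) 2 volume).toReal
          ≤ η ^ (-(γ / r)) * (2 * A φ) := by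
            refine mul_le_mul (Real.rpow_le_rpow_of_nonpos hη0 hz (by linarith))
              (h1.trans (by linarith)) ENNReal.toReal_nonneg (by positivity)
        _ ≤ _ := by
            have : 0 ≤ C * A φ + 1 / 2 * H φ := by positivity
            linarith
  have huH : uHolder (γ / r) φ = l2norm φ + H φ := rfl
  rw [huH]
  change _ ≤ _ * A φ
  linarith

end
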